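/- Let p be a prime with p ≥ 5, and let F_{p−1} ∈ M_{p−1}(Γ_2)_{Z_(p)} satisfy F_{p−1} ≡ 1 (mod p); write F_{p−1} = A(G_4, G_6, X_{10}, X_{12}) with A ∈ Z_(p)[x_1,x_2,x_3,x_4]. Then the algebra of Siegel modular forms mod p of degree 2 and even weight, M̃^{(e)}(Γ_2)_p := Σ_{k ∈ 2Z} M̃_k(Γ_2)_p, is isomorphic to F_p[x_1,x_2,x_3,x_4]/(Ã − 1), where (Ã − 1) is the principal ideal generated by the mod-p reduction Ã of A minus 1. -/

import Mathlib

open Complex Matrix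
open scoped ComplexOrder

noncomputable section

/-- `√d_K` for an imaginary quadratic discriminant `d < 0`,
taken as `√|d| · i` in the upper half plane. -/
def sqrtD (d : ℤ) : ℂ := Real.sqrt (-d) * Complex.I

/-- The ring of integers `O_K = ℤ[(d + √d)/2]` of the imaginary quadratic field of
discriminant `d`, viewed as a subset of `ℂ`. -/
def ringInt (d : ℤ) : Set ℂ :=
  {z | ∃ a b : ℤ, z = (a : ℂ) + (b : ℂ) * (((d : ℂ) + sqrtD d) / 2)}

/-- The inverse different `D_K⁻¹ = O_K / √d_K`. -/
def invDiff (d : ℤ) : Set ℂ := {z | sqrtD d * z ∈ ringInt d}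

/-- The Hermitian upper half-space of degree 2:
`Z` with `(Z - ᵗZ̄)/(2i)` positive definite. -/
def HermitianUpperHalfSpace : Set (Matrix (Fin 2) (Fin 2) ℂ) :=
  {Z | ((Z - Zᴴ).map (fun w => w / (2 * Complex.I))).PosDef}

/-- The lattice `Λ₂(K)`: Hermitian matrices with integral diagonal and
`√d_K ·`(off-diagonal entries) in `O_K`. -/
def LambdaH (d : ℤ) : Set (Matrix (Fin 2) (Fin 2) ℂ) :=
  {H | H.IsHermitian ∧ (∀ i, ∃ n : ℤ, H i i = (n : ℂ)) ∧
    ∀ i j, sqrtD d * H i j ∈ ringInt d}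

/-- Semi-positive elements of `Λ₂(K)`, the index set of Fourier expansions. -/
def HermLattice (d : ℤ) : Set (Matrix (Fin 2) (Fin 2) ℂ) :=
  {H | H ∈ LambdaH d ∧ H.PosSemidef}

/-- The symplectic-form matrix `J₂ = [[0, -1], [1, 0]]` (2×2 blocks). -/
def J2 : Matrix (Fin 2 ⊕ Fin 2) (Fin 2 ⊕ Fin 2) ℂ :=
  Matrix.fromBlocks 0 (-1) 1 0

/-- The Hermitian modular group `U₂(O_K)`:
matrices with entries in `O_K` satisfying `ᵗM̄ J₂ M = J₂`. -/
def HermitianModularGroup (d : ℤ) : Set (Matrix (Fin 2 ⊕ Fin 2) (Fin 2 ⊕ Fin 2) ℂ) :=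
  {M | (∀ i j, M i j ∈ ringInt d) ∧ Mᴴ * J2 * M = J2}

/-- The fractional-linear action `Z ↦ (AZ + B)(CZ + D)⁻¹`. -/
def matAct (M : Matrix (Fin 2 ⊕ Fin 2) (Fin 2 ⊕ Fin 2) ℂ)
    (Z : Matrix (Fin 2) (Fin 2) ℂ) : Matrix (Fin 2) (Fin 2) ℂ :=
  (M.toBlocks₁₁ * Z + M.toBlocks₁₂) * (M.toBlocks₂₁ * Z + M.toBlocks₂₂)⁻¹

/-- The character `ν_k`: `det^{k/2}` for `K = ℚ(√-1)` (i.e. `d = -4`, `k` even),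
and `det^k` for `K = ℚ(√-3)` (i.e. `d = -3`). -/
def nuChar (d k : ℤ) (M : Matrix (Fin 2 ⊕ Fin 2) (Fin 2 ⊕ Fin 2) ℂ) : ℂ :=
  if d = -4 then M.det ^ (k / 2) else M.det ^ k

/-- A Hermitian modular form of degree 2, weight `k` and character `ν_k` for `U₂(O_K)`,
bundled with its Fourier expansion over the semi-positive part of `Λ₂(K)`. -/
structure HermitianModularForm (d k : ℤ) where
  toFun : Matrix (Fin 2) (Fin 2) ℂ → ℂ
  coeff : Matrix (Fin 2) (Fin 2) ℂ → ℂ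
  holo : DifferentiableOn ℂ (fun Z : Fin 2 → Fin 2 → ℂ => toFun (Matrix.of Z))
    {Z | Matrix.of Z ∈ HermitianUpperHalfSpace}
  transform : ∀ M ∈ HermitianModularGroup d, ∀ Z ∈ HermitianUpperHalfSpace,
    toFun (matAct M Z) =
      nuChar d k M * (M.toBlocks₂₁ * Z + M.toBlocks₂₂).det ^ k * toFun Z
  coeff_supported : ∀ H, coeff H ≠ 0 → H ∈ HermLattice d
  expansion : ∀ Z ∈ HermitianUpperHalfSpace,
    HasSum (fun H : HermLattice d =>
      coeff H * Complex.exp (2 * Real.pi * Complex.I * ((H : Matrix (Fin 2) (Fin 2) ℂ) * Z).trace))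
      (toFun Z)

/-- A Hermitian modular form is symmetric if `f(ᵗZ) = f(Z)`. -/
def IsSymmetricHMF {d k : ℤ} (f : HermitianModularForm d k) : Prop :=
  ∀ Z ∈ HermitianUpperHalfSpace, f.toFun Zᵀ = f.toFun Z

/-- `z` is a `p`-integral rational number: `z = a/b` with `p ∤ b`. -/
def IsPIntegral (p : ℕ) (z : ℂ) : Prop :=
  ∃ a b : ℤ, ¬ (p : ℤ) ∣ b ∧ (b : ℂ) * z = (a : ℂ)

/-- `z ≡ w (mod p^l)` in the local ring `ℤ_(p)`, i.e. `(z - w)/p^l` is `p`-integral. -/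
def ModCongr (p l : ℕ) (z w : ℂ) : Prop :=
  IsPIntegral p ((z - w) / (p : ℂ) ^ l)


/-- The lexicographic order on `Λ₂(K)` used to define `ord_p`:
compare first `tr H`, then the `(1,1)`-entry `m`, then (for off-diagonal entry
`(a + b i)/2`) first `a`, then `b`. -/
def lexLt (H H' : Matrix (Fin 2) (Fin 2) ℂ) : Prop :=
  H.trace.re < H'.trace.re ∨
    (H.trace = H'.trace ∧
      ((H 0 0).re < (H' 0 0).re ∨
        (H 0 0 = H' 0 0 ∧
          ((H 0 1).re < (H' 0 1).re ∨
            ((H 0 1).re = (H' 0 1).re ∧ (H 0 1).im < (H' 0 1).im)))))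

/-- The Siegel upper half-space of degree `n`: symmetric complex matrices with
positive definite imaginary part. -/
def SiegelUpperHalfSpace (n : ℕ) : Set (Matrix (Fin n) (Fin n) ℂ) :=
  {Z | Z.IsSymm ∧ ((Z - Zᴴ).map (fun w => w / (2 * Complex.I))).PosDef}

/-- The symplectic-form matrix over `ℤ` in degree `n`. -/
def Jn (n : ℕ) : Matrix (Fin n ⊕ Fin n) (Fin n ⊕ Fin n) ℤ :=
  Matrix.fromBlocks 0 (-1) 1 0

/-- The Siegel modular group `Γ_n = Sp_n(ℤ)` (as a set of `2n × 2n` integer matrices). -/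
def SiegelModularGroup (n : ℕ) : Set (Matrix (Fin n ⊕ Fin n) (Fin n ⊕ Fin n) ℤ) :=
  {M | Mᵀ * Jn n * M = Jn n}

/-- The fractional-linear action of an integral symplectic matrix on the Siegel
upper half-space. -/
def matActS {n : ℕ} (M : Matrix (Fin n ⊕ Fin n) (Fin n ⊕ Fin n) ℤ)
    (Z : Matrix (Fin n) (Fin n) ℂ) : Matrix (Fin n) (Fin n) ℂ :=
  ((M.map (fun a => (a : ℂ))).toBlocks₁₁ * Z + (M.map (fun a => (a : ℂ))).toBlocks₁₂) *
    ((M.map (fun a => (a : ℂ))).toBlocks₂₁ * Z + (M.map (fun a => (a : ℂ))).toBlocks₂₂)⁻¹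

/-- The index lattice of Fourier expansions of Siegel modular forms of level `N`:
semi-positive symmetric rational matrices `T` with `N·T` half-integral,
i.e. `T ∈ (1/N)Λ_n`. -/
def SiegelLattice (n : ℕ) (N : ℕ) : Set (Matrix (Fin n) (Fin n) ℚ) :=
  {T | T.IsSymm ∧ (∀ i, ∃ a : ℤ, (N : ℚ) * T i i = (a : ℚ)) ∧
    (∀ i j, ∃ a : ℤ, 2 * (N : ℚ) * T i j = (a : ℚ)) ∧
    (T.map (fun q => (q : ℝ))).PosSemidef}

/-- A Siegel modular form of degree `n` and weight `k` for a subgroup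
`Γ ⊆ Γ_n = Sp_n(ℤ)` of level `N`, bundled with its Fourier expansion. For the
full modular group take `Γ = SiegelModularGroup n` and `N = 1`. -/
structure SiegelModularForm (n : ℕ) (k : ℤ)
    (Γ : Set (Matrix (Fin n ⊕ Fin n) (Fin n ⊕ Fin n) ℤ)) (N : ℕ) where
  toFun : Matrix (Fin n) (Fin n) ℂ → ℂ
  coeff : Matrix (Fin n) (Fin n) ℚ → ℂ
  holo : DifferentiableOn ℂ (fun Z : Fin n → Fin n → ℂ => toFun (Matrix.of Z))
    {Z | Matrix.of Z ∈ SiegelUpperHalfSpace n}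
  transform : ∀ M ∈ Γ, ∀ Z ∈ SiegelUpperHalfSpace n,
    toFun (matActS M Z) =
      ((M.map (fun a => (a : ℂ))).toBlocks₂₁ * Z +
        (M.map (fun a => (a : ℂ))).toBlocks₂₂).det ^ k * toFun Z
  coeff_supported : ∀ T, coeff T ≠ 0 → T ∈ SiegelLattice n N
  expansion : ∀ Z ∈ SiegelUpperHalfSpace n,
    HasSum (fun T : SiegelLattice n N =>
      coeff T * Complex.exp (2 * Real.pi * Complex.I *
        (((T : Matrix (Fin n) (Fin n) ℚ).map (fun q => (q : ℂ))) * Z).trace))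
      (toFun Z)


/-- A Hermitian cusp form (degree 2, class number one field): the Fourier
coefficients vanish off the positive definite part of the lattice. -/
def IsCuspHMF {d k : ℤ} (f : HermitianModularForm d k) : Prop :=
  ∀ H, ¬ H.PosDef → f.coeff H = 0

/-- `H0 = ord_p f`: `H0` is the minimal element of `Λ₂(K)`, in the lexicographic
order `lexLt`, whose Fourier coefficient is not divisible by `p`. -/
def IsOrdP (p : ℕ) {d k : ℤ} (f : HermitianModularForm d k)
    (H0 : Matrix (Fin 2) (Fin 2) ℂ) : Prop :=
  H0 ∈ HermLattice d ∧ ¬ ModCongr p 1 (f.coeff H0) 0 ∧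
    ∀ H ∈ HermLattice d, lexLt H H0 → ModCongr p 1 (f.coeff H) 0

section

open MvPolynomial

/-- The homomorphism `f ↦ f(x_i T^{w i})` recording the weights of the monomials of `f`. -/
noncomputable def weightGrading {σ R : Type*} [CommRing R] (w : σ → ℕ) :
    MvPolynomial σ R →ₐ[R] Polynomial (MvPolynomial σ R) :=
  aeval fun i => Polynomial.C (X i) * Polynomial.X ^ w i

section Grading

variable {σ R : Type*} [CommRing R] {w : σ → ℕ}

theorem weightGrading_monomial (d : σ →₀ ℕ) (r : R) :
    weightGrading w (monomial d r) =
      Polynomial.C (monomial d r) * Polynomial.X ^ Finsupp.weight w d := by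
  rw [weightGrading, aeval_monomial, monomial_eq, Finsupp.weight_apply, Finsupp.prod, Finsupp.sum,
    ← Finset.prod_pow_eq_pow_sum, map_mul, Finsupp.prod, map_prod]
  simp only [mul_pow, Finset.prod_mul_distrib, map_pow, ← pow_mul, smul_eq_mul, mul_assoc,
    mul_comm (w _)]
  rfl

theorem weightGrading_of_isWeightedHomogeneous {f : MvPolynomial σ R} {n : ℕ}
    (hf : IsWeightedHomogeneous w f n) :
    weightGrading w f = Polynomial.C f * Polynomial.X ^ n := by
  conv_lhs => rw [f.as_sum]
  conv_rhs => rw [f.as_sum]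
  rw [map_sum, map_sum, Finset.sum_mul]
  refine Finset.sum_congr rfl fun d hd => ?_
  rw [weightGrading_monomial, hf (mem_support_iff.1 hd)]

theorem coeff_weightGrading (f : MvPolynomial σ R) (n : ℕ) :
    (weightGrading w f).coeff n = weightedHomogeneousComponent w n f := by
  classical
  induction f using MvPolynomial.induction_on' with
  | monomial d r =>
    rw [weightGrading_monomial, Polynomial.coeff_C_mul_X_pow]
    split_ifs with h
    · exact (IsWeightedHomogeneous.weightedHomogeneousComponent_same
        (isWeightedHomogeneous_monomial w d r h.symm)).symm
    · exact (IsWeightedHomogeneous.weightedHomogeneousComponent_ne n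
        (isWeightedHomogeneous_monomial w d r rfl) h).symm
  | add p q hp hq => rw [map_add, Polynomial.coeff_add, hp, hq, map_add]

theorem isWeightedHomogeneous_of_weightGrading {f : MvPolynomial σ R} {n : ℕ}
    (h : weightGrading w f = Polynomial.C f * Polynomial.X ^ n) :
    IsWeightedHomogeneous w f n := by
  have := coeff_weightGrading (w := w) f n
  rw [h, Polynomial.coeff_C_mul_X_pow, if_pos rfl] at this
  rw [this]
  exact weightedHomogeneousComponent_isWeightedHomogeneous n f

theorem eval_one_weightGrading (f : MvPolynomial σ R) :
    (weightGrading w f).eval 1 = f := by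
  induction f using MvPolynomial.induction_on' with
  | monomial d r => simp [weightGrading_monomial]
  | add p q hp hq => rw [map_add, Polynomial.eval_add, hp, hq]

theorem weightGrading_injective :
    Function.Injective (weightGrading w : MvPolynomial σ R → _) := fun f g h => by
  rw [← eval_one_weightGrading (w := w) f, h, eval_one_weightGrading]

theorem isWeightedHomogeneous_of_mul_left [IsDomain R] {f g : MvPolynomial σ R} {n : ℕ}
    (hn : IsWeightedHomogeneous w (f * g) n) (h0 : f * g ≠ 0) :
    ∃ m, IsWeightedHomogeneous w f m := by
  have h := weightGrading_of_isWeightedHomogeneous hn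
  have hf0 : weightGrading w f ≠ 0 := by
    rw [Ne, map_eq_zero_iff _ weightGrading_injective]; exact left_ne_zero_of_mul h0
  have hg0 : weightGrading w g ≠ 0 := by
    rw [Ne, map_eq_zero_iff _ weightGrading_injective]; exact right_ne_zero_of_mul h0
  have h1 := Polynomial.natDegree_mul hf0 hg0
  have h2 := Polynomial.natTrailingDegree_mul hf0 hg0
  rw [← map_mul, h, Polynomial.natDegree_C_mul_X_pow _ _ h0] at h1
  rw [← map_mul, h, Polynomial.C_mul_X_pow_eq_monomial,
    Polynomial.natTrailingDegree_monomial h0] at h2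
  have h3 := Polynomial.natTrailingDegree_le_natDegree (weightGrading w f)
  have h4 := Polynomial.natTrailingDegree_le_natDegree (weightGrading w g)
  obtain ⟨m, hm⟩ : ∃ m, m = (weightGrading w f).natDegree := ⟨_, rfl⟩
  rw [← hm] at h1 h3
  refine ⟨m, ?_⟩
  have h5 : weightGrading w f = Polynomial.C ((weightGrading w f).coeff m) * Polynomial.X ^ m := by
    ext1 j
    rw [Polynomial.coeff_C_mul_X_pow]
    split_ifs with hj
    · rw [hj]
    · rcases lt_or_gt_of_ne hj with hj | hj
      · exact Polynomial.coeff_eq_zero_of_lt_natTrailingDegree (by omega)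
      · exact Polynomial.coeff_eq_zero_of_natDegree_lt (hm ▸ hj)
  have h6 := eval_one_weightGrading (w := w) f
  rw [h5] at h6
  simp only [Polynomial.eval_mul, Polynomial.eval_C, Polynomial.eval_pow, Polynomial.eval_X,
    one_pow, mul_one] at h6
  rw [h6] at h5
  exact isWeightedHomogeneous_of_weightGrading h5

theorem IsWeightedHomogeneous.of_dvd [IsDomain R] {f g : MvPolynomial σ R} {n : ℕ}
    (hn : IsWeightedHomogeneous w g n) (h0 : g ≠ 0) (h : f ∣ g) :
    ∃ m ≤ n, IsWeightedHomogeneous w f m := by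
  obtain ⟨k, rfl⟩ := h
  obtain ⟨m, hm⟩ := isWeightedHomogeneous_of_mul_left hn h0
  obtain ⟨m', hm'⟩ := isWeightedHomogeneous_of_mul_left (mul_comm f k ▸ hn) (mul_comm f k ▸ h0)
  have := IsWeightedHomogeneous.inj_right h0 hn (hm.mul hm')
  exact ⟨m, by omega, hm⟩

theorem not_isUnit_of_isWeightedHomogeneous [IsDomain R] {f : MvPolynomial σ R}
    {n : ℕ} (hn : IsWeightedHomogeneous w f n) (hn0 : n ≠ 0) : ¬ IsUnit f := fun h => by
  obtain ⟨g, hg⟩ := h.exists_right_inv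
  obtain ⟨m, hm⟩ := isWeightedHomogeneous_of_mul_left (w := w) (f := g) (g := f) (n := 0)
    (by rw [mul_comm, hg]; exact isWeightedHomogeneous_one R w) (by rw [mul_comm, hg]; simp)
  have h1 := hn.mul hm
  rw [hg] at h1
  have := IsWeightedHomogeneous.inj_right one_ne_zero (isWeightedHomogeneous_one R w) h1
  omega

theorem eq_C_of_isWeightedHomogeneous_zero (hw : ∀ i, w i ≠ 0) {f : MvPolynomial σ R}
    (hf : IsWeightedHomogeneous w f 0) : f = C (f.coeff 0) := by
  classical
  ext d
  rw [coeff_C]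
  split_ifs with h
  · rw [h]
  · refine hf.coeff_eq_zero d fun h1 => h ?_
    exact (Finsupp.ext ((weightedDegree_eq_zero_iff (nonTorsionWeight_of hw)).1 h1)).symm

end Grading

/-- The automorphism `x_i ↦ u^{w i} x_i`. -/
noncomputable def weightScale {σ R : Type*} [CommRing R] (w : σ → ℕ) (u : R) :
    MvPolynomial σ R →ₐ[R] MvPolynomial σ R :=
  aeval fun i => C (u ^ w i) * X i

section Scale

variable {σ R : Type*} [CommRing R] {w : σ → ℕ}

theorem weightScale_monomial (u : R) (d : σ →₀ ℕ) (r : R) :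
    weightScale w u (monomial d r) = monomial d (u ^ Finsupp.weight w d * r) := by
  rw [weightScale, aeval_monomial, Finsupp.prod, monomial_eq, Finsupp.weight_apply, Finsupp.sum,
    ← Finset.prod_pow_eq_pow_sum, Finsupp.prod]
  simp only [mul_pow, Finset.prod_mul_distrib, map_prod, ← pow_mul, smul_eq_mul, map_mul,
    mul_comm (w _), map_pow, algebraMap_eq]
  ring

theorem coeff_weightScale (u : R) (f : MvPolynomial σ R) (d : σ →₀ ℕ) :
    (weightScale w u f).coeff d = u ^ Finsupp.weight w d * f.coeff d := by
  classical
  induction f using MvPolynomial.induction_on' with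
  | monomial e r =>
    rw [weightScale_monomial, coeff_monomial, coeff_monomial]
    split_ifs with h
    · rw [h]
    · rw [mul_zero]
  | add p q hp hq => rw [map_add, coeff_add, hp, hq, coeff_add, mul_add]

theorem weightScale_weightScale (u v : R) (f : MvPolynomial σ R) :
    weightScale w u (weightScale w v f) = weightScale w (u * v) f := by
  ext d
  simp only [coeff_weightScale, mul_pow, mul_assoc]

theorem weightScale_one (f : MvPolynomial σ R) : weightScale w 1 f = f := by
  ext d
  simp only [coeff_weightScale, one_pow, one_mul]

theorem weightGrading_weightScale (u : R) (f : MvPolynomial σ R) :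
    weightGrading w (weightScale w u f) =
      (weightGrading w f).comp (Polynomial.C (C u) * Polynomial.X) := by
  induction f using MvPolynomial.induction_on' with
  | monomial e r =>
    rw [weightScale_monomial, weightGrading_monomial, weightGrading_monomial]
    simp only [Polynomial.mul_comp, Polynomial.C_comp, Polynomial.pow_comp, Polynomial.X_comp,
      mul_pow, ← C_mul_monomial, map_mul, map_pow]
    ring
  | add p q hp hq => rw [map_add, map_add, map_add, hp, hq, Polynomial.add_comp]

theorem weightScale_isUnit_prime (u : Rˣ) {f : MvPolynomial σ R} (hf : Prime f) :
    Prime (weightScale w (u : R) f) := by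
  let e : MvPolynomial σ R ≃ₐ[R] MvPolynomial σ R :=
    AlgEquiv.ofAlgHom (weightScale w (u : R)) (weightScale w ((u⁻¹ : Rˣ) : R))
      (by ext1 i; simp [weightScale_weightScale, weightScale_one])
      (by ext1 i; simp [weightScale_weightScale, weightScale_one])
  exact (MulEquiv.prime_iff e).2 hf

end Scale

section Kernel

variable {p : ℕ} [Fact p.Prime] {σ L : Type*} [CommRing L] {w : σ → ℕ}
  {ev : MvPolynomial σ (ZMod p) →+* L} {A : MvPolynomial σ (ZMod p)}

theorem sub_one_dvd_of_weights_dvd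
    (hev : ∀ n f, IsWeightedHomogeneous w f n → ev f = 0 → f = 0)
    (hA : IsWeightedHomogeneous w A (p - 1)) (hA1 : ev A = 1)
    {f : MvPolynomial σ (ZMod p)} (hf : ∀ d ∈ f.support, p - 1 ∣ Finsupp.weight w d)
    (h0 : ev f = 0) : A - 1 ∣ f := by
  classical
  choose! j hj using hf
  set J := f.support.sup j
  have hJ : ∀ d ∈ f.support, j d ≤ J := fun d hd => Finset.le_sup hd
  set h := ∑ d ∈ f.support, monomial d (f.coeff d) * A ^ (J - j d) with hdef
  have hh : h = 0 := by
    refine hev ((p - 1) * J) h (IsWeightedHomogeneous.sum _ _ _ fun d hd => ?_) ?_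
    · have := (isWeightedHomogeneous_monomial w d (f.coeff d) rfl).mul (hA.pow (J - j d))
      rw [hj d hd, smul_eq_mul, mul_comm (J - j d), ← mul_add] at this
      rwa [Nat.add_sub_cancel' (hJ d hd)] at this
    · rw [hdef, map_sum]
      simp only [map_mul, map_pow, hA1, one_pow, mul_one]
      rw [← map_sum, support_sum_monomial_coeff, h0]
  have : f = ∑ d ∈ f.support, monomial d (f.coeff d) * (1 - A ^ (J - j d)) := by
    simp only [mul_sub, Finset.sum_sub_distrib, mul_one]
    rw [support_sum_monomial_coeff, ← hdef, hh, sub_zero]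
  rw [this]
  refine Finset.dvd_sum fun d _ => Dvd.dvd.mul_left ?_ _
  rw [dvd_sub_comm]
  simpa using sub_dvd_pow_sub_pow A 1 (J - j d)

theorem sub_one_dvd_prod_weightScale
    (hev : ∀ n f, IsWeightedHomogeneous w f n → ev f = 0 → f = 0)
    (hA : IsWeightedHomogeneous w A (p - 1)) (hA1 : ev A = 1)
    {f : MvPolynomial σ (ZMod p)} (h0 : ev f = 0) :
    A - 1 ∣ ∏ u : (ZMod p)ˣ, weightScale w (u : ZMod p) f := by
  classical
  refine sub_one_dvd_of_weights_dvd hev hA hA1 (fun d hd => ?_) ?_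
  · have key := FiniteField.forall_pow_eq_one_iff (ZMod p) (Finsupp.weight w d)
    rw [ZMod.card] at key
    refine key.1 fun v => ?_
    have hinv : weightScale w (v : ZMod p) (∏ u : (ZMod p)ˣ, weightScale w (u : ZMod p) f) =
        ∏ u : (ZMod p)ˣ, weightScale w (u : ZMod p) f := by
      rw [map_prod]
      refine Fintype.prod_equiv (Equiv.mulLeft v) _ _ fun u => ?_
      rw [weightScale_weightScale]; simp
    have h2 := congrArg (coeff d) hinv
    rw [coeff_weightScale] at h2
    ext
    push_cast
    exact mul_right_cancel₀ (mem_support_iff.1 hd) (h2.trans (one_mul _).symm)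
  · rw [map_prod]
    exact Finset.prod_eq_zero (Finset.mem_univ 1) (by simpa [weightScale_one] using h0)

theorem sub_one_dvd_of_map_eq_zero [IsDomain L]
    (hev : ∀ n f, IsWeightedHomogeneous w f n → ev f = 0 → f = 0)
    (hA : IsWeightedHomogeneous w A (p - 1)) (hA1 : ev A = 1) (hsq : Squarefree A)
    {f : MvPolynomial σ (ZMod p)} (hf : ev f = 0) : A - 1 ∣ f := by
  classical
  have hp1 : p - 1 ≠ 0 := by have := (Fact.out : p.Prime).two_le; omega
  have hAu : ¬ IsUnit A := not_isUnit_of_isWeightedHomogeneous hA hp1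
  have hA0 : A ≠ 0 := hsq.ne_zero
  have hB0 : A - 1 ≠ 0 := fun h => hAu (by rw [sub_eq_zero.1 h]; exact isUnit_one)
  have hevB : ev (A - 1) = 0 := by rw [map_sub, hA1, map_one, sub_self]
  have hprime : Prime (A - 1) := by
    obtain ⟨s, hs, v, hv⟩ := UniqueFactorizationMonoid.exists_prime_factors (A - 1) hB0
    have hs0 : ev s.prod = 0 := by
      have := congrArg ev hv
      rw [hevB, map_mul] at this
      exact (mul_eq_zero.1 this).resolve_right ((v.isUnit.map ev).ne_zero)
    rw [map_multiset_prod, Multiset.prod_eq_zero_iff, Multiset.mem_map] at hs0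
    obtain ⟨β, hβs, hβ⟩ := hs0
    obtain ⟨g, hg⟩ := sub_one_dvd_prod_weightScale hev hA hA1 hβ
    obtain ⟨t, _, b, c, -, -, hbc, ht, -⟩ := mul_eq_mul_prime_prod (x := A - 1) (y := g) (a := 1)
      (s := Finset.univ) (p := fun u : (ZMod p)ˣ => weightScale w (u : ZMod p) β)
      (fun u _ => weightScale_isUnit_prime u (hs β hβs)) (by rw [one_mul, hg])
    have hb : IsUnit b := .of_mul_eq_one c hbc.symm
    set β' := (weightGrading w β).leadingCoeff
    have htop : ∀ u : (ZMod p)ˣ, (weightGrading w (weightScale w (u : ZMod p) β)).leadingCoeff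
        = β' * C (u : ZMod p) ^ (weightGrading w β).natDegree := fun u => by
      have hu : (C (u : ZMod p) : MvPolynomial σ (ZMod p)) ≠ 0 := by simp
      rw [weightGrading_weightScale, Polynomial.leadingCoeff_comp, Polynomial.leadingCoeff_C_mul_X]
      rw [Polynomial.natDegree_C_mul_X _ hu]; exact one_ne_zero
    have hA' : A = (weightGrading w b).leadingCoeff *
        ∏ u ∈ t, (β' * C (u : ZMod p) ^ (weightGrading w β).natDegree) := by
      have h1 := congrArg (fun q => (weightGrading w q).leadingCoeff) ht
      simp only [map_mul, map_prod, Polynomial.leadingCoeff_mul, Polynomial.leadingCoeff_prod,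
        htop] at h1
      rw [← h1, map_sub, weightGrading_of_isWeightedHomogeneous hA, map_one,
        Polynomial.leadingCoeff_sub_of_degree_lt, Polynomial.leadingCoeff_C_mul_X_pow]
      rw [Polynomial.degree_C_mul_X_pow _ hA0, Polynomial.degree_one]
      exact_mod_cast Nat.pos_of_ne_zero hp1
    have hbu : IsUnit (weightGrading w b).leadingCoeff :=
      (hb.map (weightGrading w)).map (Polynomial.leadingCoeffHom (R := MvPolynomial σ (ZMod p)))
    have hcu : ∀ u : (ZMod p)ˣ, IsUnit ((C (u : ZMod p) : MvPolynomial σ (ZMod p)) ^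
        (weightGrading w β).natDegree) := fun u => (u.isUnit.map C).pow _
    rw [Finset.prod_mul_distrib, Finset.prod_const] at hA'
    have hcard : t.card = 1 := by
      by_contra hne
      rcases Nat.lt_or_ge t.card 2 with h | h
      · have h0 : t.card = 0 := by omega
        rw [Finset.card_eq_zero] at h0
        rw [h0, Finset.prod_empty, mul_one] at ht
        exact (hb.map ev).ne_zero (ht ▸ hevB)
      · have hβu : IsUnit β' := hsq β' <| by
          rw [hA', ← pow_two]
          exact Dvd.dvd.mul_left (Dvd.dvd.mul_right (pow_dvd_pow _ h) _) _
        refine hAu ?_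
        rw [hA']
        exact hbu.mul ((hβu.pow _).mul (Finset.prod_induction _ IsUnit (fun _ _ => IsUnit.mul)
          isUnit_one fun u _ => hcu u))
    obtain ⟨u, rfl⟩ := Finset.card_eq_one.1 hcard
    rw [Finset.prod_singleton] at ht
    obtain ⟨b, rfl⟩ := hb
    exact (associated_unit_mul_left _ _ b.isUnit).symm.prime
      (weightScale_isUnit_prime u (hs β hβs)) |> fun h => ht ▸ h
  obtain ⟨u, -, hu⟩ := hprime.exists_mem_finset_dvd (sub_one_dvd_prod_weightScale hev hA hA1 hf)
  have hscale : weightScale w ((u⁻¹ : (ZMod p)ˣ) : ZMod p) A = A := by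
    ext d
    rw [coeff_weightScale]
    by_cases hd : A.coeff d = 0
    · rw [hd, mul_zero]
    · rw [hA hd, ZMod.pow_card_sub_one_eq_one (Units.ne_zero _), one_mul]
  have h3 := map_dvd (weightScale w ((u⁻¹ : (ZMod p)ˣ) : ZMod p)) hu
  rwa [map_sub, hscale, map_one, weightScale_weightScale, Units.inv_mul, weightScale_one] at h3

end Kernel

/-- The operator `q d/dq` on power series. -/
noncomputable def qDeriv (R : Type*) [CommRing R] : Derivation R (PowerSeries R) (PowerSeries R) :=
  (PowerSeries.X : PowerSeries R) • PowerSeries.derivative R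

theorem coeff_qDeriv {R : Type*} [CommRing R] (f : PowerSeries R) (n : ℕ) :
    PowerSeries.coeff n (qDeriv R f) = n * PowerSeries.coeff n f := by
  simp only [qDeriv, Derivation.smul_apply, smul_eq_mul]
  cases n with
  | zero => simp
  | succ n => rw [PowerSeries.coeff_succ_X_mul, PowerSeries.coeff_derivative]; push_cast; ring

/-- Power series satisfying Ramanujan's differential equations, with the initial coefficients of
the Eisenstein series of weights `2`, `4`, `6`. -/
structure IsRamanujanTriple {R : Type*} [CommRing R] (P Q S : PowerSeries R) : Prop where
  deriv_P : 12 * qDeriv R P = P ^ 2 - Q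
  deriv_Q : 12 * qDeriv R Q = 4 * (P * Q - S)
  deriv_S : 12 * qDeriv R S = 6 * (P * S - Q ^ 2)
  coeff_zero_P : PowerSeries.coeff 0 P = 1
  coeff_zero_Q : PowerSeries.coeff 0 Q = 1
  coeff_zero_S : PowerSeries.coeff 0 S = 1
  coeff_one_Q : PowerSeries.coeff 1 Q = 240
  coeff_one_S : PowerSeries.coeff 1 S = -504

theorem weight_four_six (d : Fin 2 →₀ ℕ) : Finsupp.weight ![4, 6] d = 4 * d 0 + 6 * d 1 := by
  rw [Finsupp.weight_apply, Finsupp.sum_fintype _ _ (by simp)]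
  simp [Fin.sum_univ_two, mul_comm]

/-- Serre's derivation on isobaric polynomials in the Eisenstein series of weights `4`, `6`. -/
noncomputable def serreDerivation (R : Type*) [CommRing R] :
    Derivation R (MvPolynomial (Fin 2) R) (MvPolynomial (Fin 2) R) :=
  mkDerivation R ![-4 * X 1, -6 * X 0 ^ 2]

section Serre

variable {R : Type*} [CommRing R] {P Q S : PowerSeries R}

theorem serreDerivation_X_zero : serreDerivation R (X 0) = -4 * X 1 := by
  simp [serreDerivation, mkDerivation_X]

theorem serreDerivation_X_one : serreDerivation R (X 1) = -6 * X 0 ^ 2 := by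
  simp [serreDerivation, mkDerivation_X]

theorem IsRamanujanTriple.serreDerivation_isobaric (h : IsRamanujanTriple P Q S) {n : ℕ}
    {f : MvPolynomial (Fin 2) R} (hf : IsWeightedHomogeneous ![4, 6] f n) :
    IsWeightedHomogeneous ![4, 6] (serreDerivation R f) (n + 2) ∧
      12 * qDeriv R (aeval ![Q, S] f) =
        aeval ![Q, S] (serreDerivation R f) + n * P * aeval ![Q, S] f := by
  let E (f : MvPolynomial (Fin 2) R) (n : ℕ) : Prop :=
    IsWeightedHomogeneous ![4, 6] f n ∧
    IsWeightedHomogeneous ![4, 6] (serreDerivation R f) (n + 2) ∧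
      12 * qDeriv R (aeval ![Q, S] f) =
        aeval ![Q, S] (serreDerivation R f) + n * P * aeval ![Q, S] f
  have hmul : ∀ f g n m, E f n → E g m → E (f * g) (n + m) := by
    rintro f g n m ⟨f1, f2, f3⟩ ⟨g1, g2, g3⟩
    refine ⟨f1.mul g1, ?_, ?_⟩
    · rw [Derivation.leibniz, smul_eq_mul, smul_eq_mul]
      have h1 := f1.mul g2
      have h2 := g1.mul f2
      rw [show n + (m + 2) = n + m + 2 by ring] at h1
      rw [show m + (n + 2) = n + m + 2 by ring] at h2
      exact h1.add h2
    · simp only [Derivation.leibniz, smul_eq_mul, map_mul, map_add]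
      push_cast
      linear_combination (aeval ![Q, S] f) * g3 + (aeval ![Q, S] g) * f3
  have hC : ∀ r, E (C r) 0 := fun r => by
    refine ⟨isWeightedHomogeneous_C _ _, ?_, ?_⟩
    · rw [← algebraMap_eq, Derivation.map_algebraMap]; exact isWeightedHomogeneous_zero _ _ _
    · rw [← algebraMap_eq, Derivation.map_algebraMap, AlgHom.commutes, Derivation.map_algebraMap]
      simp
  have hpow : ∀ f n m, E f n → E (f ^ m) (m * n) := fun f n m hf => by
    induction m with
    | zero => simpa using hC 1
    | succ m ih => rw [pow_succ, add_mul, one_mul]; exact hmul _ _ _ _ ih hf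
  have h0 : E (X 0) 4 := by
    refine ⟨isWeightedHomogeneous_X R _ 0, ?_, ?_⟩
    · rw [serreDerivation_X_zero, show (-4 : MvPolynomial (Fin 2) R) = C (-4) by rw [map_neg, map_ofNat]]
      exact (isWeightedHomogeneous_X R ![4, 6] 1).C_mul _
    · rw [serreDerivation_X_zero]
      simp only [aeval_X, Matrix.cons_val_zero, Matrix.cons_val_one, map_mul, map_neg]
      rw [h.deriv_Q, map_ofNat]; push_cast; ring
  have h1 : E (X 1) 6 := by
    refine ⟨isWeightedHomogeneous_X R _ 1, ?_, ?_⟩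
    · rw [serreDerivation_X_one, show (-6 : MvPolynomial (Fin 2) R) = C (-6) by rw [map_neg, map_ofNat]]
      exact ((isWeightedHomogeneous_X R ![4, 6] 0).pow 2).C_mul _
    · rw [serreDerivation_X_one]
      simp only [aeval_X, Matrix.cons_val_zero, Matrix.cons_val_one, map_mul, map_neg, map_pow]
      rw [h.deriv_S, map_ofNat]; push_cast; ring
  have hmon : ∀ d ∈ f.support, E (monomial d (f.coeff d)) n := fun d hd => by
    have := hmul _ _ _ _ (hC (f.coeff d)) (hmul _ _ _ _ (hpow _ _ (d 0) h0) (hpow _ _ (d 1) h1))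
    rw [← mul_assoc, ← monomial_fin_two, zero_add] at this
    have hw := hf (mem_support_iff.1 hd)
    rw [weight_four_six] at hw
    rwa [show d 0 * 4 + d 1 * 6 = n by omega] at this
  rw [← support_sum_monomial_coeff f]
  simp only [map_sum, Finset.mul_sum, ← Finset.sum_add_distrib]
  exact ⟨IsWeightedHomogeneous.sum _ _ _ fun d hd => (hmon d hd).2.1,
    Finset.sum_congr rfl fun d hd => (hmon d hd).2.2⟩

theorem X_cube_sub_dvd_of_isWeightedHomogeneous {n : ℕ} {f : MvPolynomial (Fin 2) R}
    (hf : IsWeightedHomogeneous ![4, 6] f n) (h0 : aeval (fun _ => (1 : R)) f = 0) :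
    (X 0 ^ 3 - X 1 ^ 2 : MvPolynomial (Fin 2) R) ∣ f := by
  rcases f.support.eq_empty_or_nonempty with he | ⟨e, he⟩
  · rw [support_eq_empty.1 he]; exact dvd_zero _
  have key : ∀ a b i : ℕ, (X 0 ^ 3 - X 1 ^ 2 : MvPolynomial (Fin 2) R) ∣
      X 0 ^ (a + 3 * i) * X 1 ^ b - X 0 ^ a * X 1 ^ (b + 2 * i) := fun a b i => by
    have := sub_dvd_pow_sub_pow (X 0 ^ 3 : MvPolynomial (Fin 2) R) (X 1 ^ 2) i
    convert this.mul_left (X 0 ^ a * X 1 ^ b) using 1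
    simp only [pow_add, pow_mul]
    ring
  have hsum : f = ∑ d ∈ f.support, C (f.coeff d) *
      (X 0 ^ d 0 * X 1 ^ d 1 - X 0 ^ e 0 * X 1 ^ e 1) := by
    simp only [mul_sub, Finset.sum_sub_distrib]
    rw [← Finset.sum_mul, ← map_sum]
    have : ∑ d ∈ f.support, f.coeff d = 0 := by
      rw [← h0]
      conv_rhs => rw [← support_sum_monomial_coeff f, map_sum]
      simp [monomial_fin_two]
    rw [this, map_zero, zero_mul, sub_zero]
    simp only [← mul_assoc, ← monomial_fin_two, support_sum_monomial_coeff]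
  rw [hsum]
  refine Finset.dvd_sum fun d hd => Dvd.dvd.mul_left ?_ _
  have hd' := hf (mem_support_iff.1 hd)
  have he' := hf (mem_support_iff.1 he)
  rw [weight_four_six] at hd' he'
  rcases le_total (e 0) (d 0) with h | h
  · obtain ⟨i, hi⟩ : ∃ i, d 0 = e 0 + 3 * i := ⟨(d 0 - e 0) / 3, by omega⟩
    rw [hi, show e 1 = d 1 + 2 * i by omega]
    exact key _ _ _
  · obtain ⟨i, hi⟩ : ∃ i, e 0 = d 0 + 3 * i := ⟨(e 0 - d 0) / 3, by omega⟩
    rw [hi, show d 1 = e 1 + 2 * i by omega, dvd_sub_comm]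
    exact key _ _ _

end Serre

theorem ZMod.natCast_ne_zero_of_lt {p m : ℕ} (h0 : 0 < m) (h : m < p) : (m : ZMod p) ≠ 0 := by
  rw [Ne, ZMod.natCast_eq_zero_iff]
  exact Nat.not_dvd_of_pos_of_lt h0 h

section Squarefree

variable {p : ℕ} [Fact p.Prime] {P Q S : PowerSeries (ZMod p)}

theorem IsRamanujanTriple.eq_zero_of_isWeightedHomogeneous (hp5 : 5 ≤ p)
    (h : IsRamanujanTriple P Q S) (n : ℕ) : ∀ f : MvPolynomial (Fin 2) (ZMod p),
    IsWeightedHomogeneous ![4, 6] f n → aeval ![Q, S] f = 0 → f = 0 := by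
  induction n using Nat.strong_induction_on with
  | _ n ih =>
    intro f hf hf0
    by_contra hne
    have h1 : aeval (fun _ => (1 : ZMod p)) f = 0 := by
      have := congrArg (PowerSeries.constantCoeff (R := ZMod p)) hf0
      rw [map_zero, aeval_def, ← coe_eval₂Hom, ← RingHom.comp_apply, comp_eval₂Hom] at this
      rw [← this, aeval_def, ← coe_eval₂Hom]
      congr 2
      funext i
      fin_cases i
      · simpa using h.coeff_zero_Q.symm
      · simpa using h.coeff_zero_S.symm
    obtain ⟨g, rfl⟩ := X_cube_sub_dvd_of_isWeightedHomogeneous hf h1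
    obtain ⟨m, hm⟩ := isWeightedHomogeneous_of_mul_left (mul_comm _ g ▸ hf) (mul_comm _ g ▸ hne)
    have h12 : IsWeightedHomogeneous ![4, 6] (X 0 ^ 3 - X 1 ^ 2 : MvPolynomial (Fin 2) (ZMod p))
        12 :=
      ((isWeightedHomogeneous_X _ ![4, 6] 0).pow 3).sub ((isWeightedHomogeneous_X _ ![4, 6] 1).pow 2)
    have hn := IsWeightedHomogeneous.inj_right hne hf (h12.mul hm)
    rw [map_mul] at hf0
    rcases mul_eq_zero.1 hf0 with h2 | h2
    · simp only [map_sub, map_pow, aeval_X, Matrix.cons_val_zero, Matrix.cons_val_one] at h2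
      have h3 := congrArg (PowerSeries.coeff 1) h2
      have e1 : PowerSeries.coeff 1 (Q ^ 3 - S ^ 2) = 1728 := by
        have := h.coeff_one_Q
        simp only [map_sub, PowerSeries.coeff_one_pow, h.coeff_one_Q, h.coeff_one_S]
        rw [← PowerSeries.coeff_zero_eq_constantCoeff_apply,
          ← PowerSeries.coeff_zero_eq_constantCoeff_apply, h.coeff_zero_Q, h.coeff_zero_S]
        norm_num
      rw [e1, map_zero] at h3
      have h4 : ((1728 : ℕ) : ZMod p) = 0 := by exact_mod_cast h3
      rw [ZMod.natCast_eq_zero_iff, show 1728 = 2 ^ 6 * 3 ^ 3 by norm_num,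
        (Fact.out : p.Prime).dvd_mul] at h4
      rcases h4 with h4 | h4 <;>
        · have := Nat.le_of_dvd (by norm_num) ((Fact.out : p.Prime).dvd_of_dvd_pow h4)
          omega
    · exact right_ne_zero_of_mul hne (ih m (by omega) g hm h2)

theorem IsRamanujanTriple.squarefree_of_aeval_eq_one (hp5 : 5 ≤ p) (h : IsRamanujanTriple P Q S)
    {B : MvPolynomial (Fin 2) (ZMod p)} (hB : IsWeightedHomogeneous ![4, 6] B (p - 1))
    (hB1 : aeval ![Q, S] B = 1) : Squarefree B := by
  have hw : ∀ i, (![4, 6] : Fin 2 → ℕ) i ≠ 0 := by intro i; fin_cases i <;> simp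
  set D := serreDerivation (ZMod p)
  have hB0 : B ≠ 0 := fun h0 => by rw [h0, map_zero] at hB1; exact zero_ne_one hB1
  have hp1 : ((p - 1 : ℕ) : PowerSeries (ZMod p)) = -1 := by
    have h0 : ((p : ℕ) : PowerSeries (ZMod p)) = 0 := by
      rw [← map_natCast (PowerSeries.C (R := ZMod p)), CharP.cast_eq_zero, map_zero]
    rw [Nat.cast_sub (by omega), h0]; simp
  obtain ⟨hDB, hDB1⟩ := h.serreDerivation_isobaric hB
  obtain ⟨hDDB, hDDB1⟩ := h.serreDerivation_isobaric hDB
  have hDBP : aeval ![Q, S] (D B) = P := by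
    rw [hB1, Derivation.map_one_eq_zero, hp1] at hDB1
    linear_combination -hDB1
  have hode : D (D B) = -(X 0 * B) := by
    rw [← sub_eq_zero, sub_neg_eq_add]
    refine h.eq_zero_of_isWeightedHomogeneous hp5 _ _
      (hDDB.add (?_ : IsWeightedHomogeneous _ _ (p - 1 + 2 + 2))) ?_
    · have := (isWeightedHomogeneous_X (ZMod p) ![4, 6] 0).mul hB
      rwa [show (![4, 6] : Fin 2 → ℕ) 0 + (p - 1) = p - 1 + 2 + 2 by simp; omega] at this
    · rw [hDBP, h.deriv_P] at hDDB1
      push_cast at hDDB1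
      rw [hp1] at hDDB1
      rw [map_add, map_mul, hB1, aeval_X, Matrix.cons_val_zero]
      linear_combination -hDDB1
  intro x hx
  by_contra hxu
  have hx0 : x ≠ 0 := fun h0 => hB0 (by rw [h0, zero_mul, zero_dvd_iff] at hx; exact hx)
  obtain ⟨β, hβ, hβx⟩ := WfDvdMonoid.exists_irreducible_factor hxu hx0
  have hβp : Prime β := hβ.prime
  have hβ2 : β ^ 2 ∣ B := (pow_dvd_pow_of_dvd hβx 2).trans (by rwa [pow_two])
  have hfin : FiniteMultiplicity β B := FiniteMultiplicity.of_not_isUnit hβ.not_isUnit hB0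
  obtain ⟨u, hBu, hu⟩ := hfin.exists_eq_pow_mul_and_not_dvd
  have he2 : 2 ≤ multiplicity β B := hfin.le_multiplicity_of_pow_dvd hβ2
  obtain ⟨e, he⟩ := Nat.exists_eq_add_of_le' he2
  rw [he] at hBu
  obtain ⟨m, hmle, hm⟩ := IsWeightedHomogeneous.of_dvd hB hB0 ((dvd_pow_self β two_ne_zero).trans hβ2)
  have hm0 : m ≠ 0 := by
    rintro rfl
    have := eq_C_of_isWeightedHomogeneous_zero hw hm
    refine hβ.not_isUnit (this ▸ (IsUnit.map C (isUnit_iff_ne_zero.2 fun h0 => hβ.ne_zero ?_)))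
    rw [this, h0, map_zero]
  have hep : e + 2 < p := by
    obtain ⟨m', hm'le, hm'⟩ := IsWeightedHomogeneous.of_dvd hB hB0 (Dvd.intro u hBu.symm)
    have := IsWeightedHomogeneous.inj_right (pow_ne_zero _ hβ.ne_zero) hm' (hm.pow (e + 2))
    rw [smul_eq_mul] at this
    have : (e + 2) * 1 ≤ (e + 2) * m := Nat.mul_le_mul_left _ (Nat.pos_of_ne_zero hm0)
    omega
  have hDβ : β ∣ D β := by
    have h1 : β ∣ C (((e + 2 : ℕ) : ZMod p) * ((e + 1 : ℕ) : ZMod p)) * (u * D β ^ 2) := by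
      have h2 := hode
      rw [hBu] at h2
      simp only [Derivation.leibniz, Derivation.leibniz_pow, map_add, smul_eq_mul,
        nsmul_eq_mul, Derivation.map_natCast] at h2
      rw [show e + 2 - 1 = e + 1 by omega] at h2
      rw [Nat.add_sub_cancel] at h2
      refine ⟨-(X 0 * β * u + β * D (D u) + 2 * ((e : MvPolynomial (Fin 2) (ZMod p)) + 2) * D β * D u
        + u * ((e : MvPolynomial (Fin 2) (ZMod p)) + 2) * D (D β)), ?_⟩
      refine mul_left_cancel₀ (pow_ne_zero e hβ.ne_zero) ?_
      push_cast at h2 ⊢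
      simp only [map_mul, map_add, map_natCast, map_ofNat, map_one]
      linear_combination h2
    have hc : ((e + 2 : ℕ) : ZMod p) * ((e + 1 : ℕ) : ZMod p) ≠ 0 :=
      mul_ne_zero (ZMod.natCast_ne_zero_of_lt (by omega) hep)
        (ZMod.natCast_ne_zero_of_lt (by omega) (by omega))
    rcases hβp.dvd_or_dvd h1 with h2 | h2
    · exact absurd (isUnit_of_dvd_unit h2 (IsUnit.map C (isUnit_iff_ne_zero.2 hc))) hβ.not_isUnit
    · exact hβp.dvd_of_dvd_pow ((hβp.dvd_or_dvd h2).resolve_left hu)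
  obtain ⟨hDβw, hDβ1⟩ := h.serreDerivation_isobaric hm
  have hDβ0 : D β = 0 := by
    by_contra hne
    obtain ⟨γ, hγ⟩ := hDβ
    have hne' : γ * β ≠ 0 := by rwa [mul_comm, ← hγ]
    obtain ⟨l, hl⟩ := isWeightedHomogeneous_of_mul_left (f := γ) (g := β)
      (by rw [mul_comm, ← hγ]; exact hDβw) hne'
    have := IsWeightedHomogeneous.inj_right hne hDβw (hγ ▸ hm.mul hl)
    refine left_ne_zero_of_mul hne' (hl.eq_zero_of_no_monomials fun d => ?_)
    rw [weight_four_six]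
    omega
  rw [hDβ0, map_zero, zero_add] at hDβ1
  have h0 := congrArg (PowerSeries.coeff 0) hDβ1
  have hβ0 : PowerSeries.constantCoeff (aeval ![Q, S] β) ≠ 0 := fun h0 => by
    obtain ⟨g, hg⟩ := (dvd_pow_self β two_ne_zero).trans hβ2
    rw [hg, map_mul] at hB1
    have := congrArg (PowerSeries.constantCoeff (R := ZMod p)) hB1
    rw [map_mul, h0, zero_mul, map_one] at this
    exact zero_ne_one this
  have hqd : PowerSeries.constantCoeff (qDeriv (ZMod p) (aeval ![Q, S] β)) = 0 := by
    rw [← PowerSeries.coeff_zero_eq_constantCoeff_apply, coeff_qDeriv]; simp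
  have hP0 := h.coeff_zero_P
  simp only [PowerSeries.coeff_zero_eq_constantCoeff, map_mul, map_natCast] at h0 hP0
  rw [hqd, hP0, mul_zero, mul_one] at h0
  exact mul_ne_zero (ZMod.natCast_ne_zero_of_lt (Nat.pos_of_ne_zero hm0) (by omega)) hβ0 h0.symm

end Squarefree

end

section QSeries

open UpperHalfPlane ModularForm Function.Periodic Filter Topology
open scoped MatrixGroups CongruenceSubgroup Manifold

/-- The function `f` on the upper half plane is the sum of the `q`-series `F`. -/
def HasQSeries (f : ℍ → ℂ) (F : PowerSeries ℂ) : Prop :=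
  ∀ z : ℍ, HasSum (fun m : ℕ => PowerSeries.coeff m F * qParam 1 z ^ m) (f z)

namespace HasQSeries

variable {f g : ℍ → ℂ} {F G : PowerSeries ℂ}

theorem add (hf : HasQSeries f F) (hg : HasQSeries g G) : HasQSeries (f + g) (F + G) :=
  fun z => by simpa [add_mul] using (hf z).add (hg z)

theorem const_mul (c : ℂ) (hf : HasQSeries f F) :
    HasQSeries (fun z => c * f z) (PowerSeries.C c * F) :=
  fun z => by simpa [mul_assoc] using (hf z).mul_left c

theorem sub (hf : HasQSeries f F) (hg : HasQSeries g G) : HasQSeries (f - g) (F - G) :=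
  fun z => by simpa [sub_mul] using (hf z).sub (hg z)

theorem mul (hf : HasQSeries f F) (hg : HasQSeries g G) : HasQSeries (f * g) (F * G) := by
  intro z
  have h := summable_norm_sum_mul_antidiagonal_of_summable_norm (hf z).summable.norm
    (hg z).summable.norm
  have h2 := tsum_mul_tsum_eq_tsum_sum_antidiagonal_of_summable_norm (hf z).summable.norm
    (hg z).summable.norm
  rw [(hf z).tsum_eq, (hg z).tsum_eq] at h2
  rw [Pi.mul_apply, h2]
  convert! h.of_norm.hasSum using 2 with m
  rw [PowerSeries.coeff_mul, Finset.sum_mul]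
  refine Finset.sum_congr rfl fun d hd => ?_
  rw [← Finset.HasAntidiagonal.mem_antidiagonal.1 hd, pow_add]
  ring

theorem exists_hasFPowerSeriesOnBall (hf : HasQSeries f F) :
    ∃ φ : ℂ → ℂ, HasFPowerSeriesOnBall φ
      (.ofScalars ℂ fun m => PowerSeries.coeff m F) 0 1 ∧ ∀ z : ℍ, φ (qParam 1 z) = f z := by
  have hs : ∀ q : ℂ, ‖q‖ < 1 → Summable fun m => PowerSeries.coeff m F * q ^ m := by
    intro q hq
    rcases eq_or_ne q 0 with rfl | hq0
    · exact summable_of_ne_finset_zero (s := {0}) fun m hm => by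
        simp only [Finset.mem_singleton] at hm
        simp [hm]
    · have := (hf ⟨invQParam 1 q, im_invQParam_pos_of_norm_lt_one one_pos hq hq0⟩).summable
      simpa [qParam_right_inv one_ne_zero hq0] using this
  refine ⟨fun q => ∑' m, PowerSeries.coeff m F * q ^ m, ⟨?_, by simp, ?_⟩, fun z => (hf z).tsum_eq⟩
  · refine le_of_forall_lt_imp_le_of_dense fun r hr => ?_
    lift r to NNReal using hr.ne_top
    apply FormalMultilinearSeries.le_radius_of_summable
    simpa [mul_comm] using (hs (r : ℝ) (by simpa using hr)).norm
  · intro y hy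
    rw [← ENNReal.coe_one, Metric.eball_coe, NNReal.coe_one, mem_ball_zero_iff] at hy
    simpa [mul_comm] using (hs y hy).hasSum

theorem mdifferentiable (hf : HasQSeries f F) : MDifferentiable 𝓘(ℂ) 𝓘(ℂ) f := by
  obtain ⟨φ, hφ, hφf⟩ := hf.exists_hasFPowerSeriesOnBall
  rw [UpperHalfPlane.mdifferentiable_iff]
  have h1 : DifferentiableOn ℂ (φ ∘ qParam 1) {z | 0 < z.im} := by
    refine hφ.differentiableOn.comp (differentiable_qParam).differentiableOn fun z hz => ?_
    rw [← ENNReal.coe_one, Metric.eball_coe, NNReal.coe_one, mem_ball_zero_iff]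
    exact norm_qParam_lt_one one_pos hz
  refine h1.congr fun z hz => ?_
  simp only [Function.comp_apply]
  rw [ofComplex_apply_of_im_pos hz, ← hφf]

theorem unique (hF : HasQSeries f F) (hG : HasQSeries f G) : F = G := by
  obtain ⟨φ, hφ, hφf⟩ := hF.exists_hasFPowerSeriesOnBall
  obtain ⟨ψ, hψ, hψf⟩ := hG.exists_hasFPowerSeriesOnBall
  have h : φ =ᶠ[𝓝 0] ψ := by
    refine (hφ.hasFPowerSeriesAt.continuousAt.eventuallyEq_nhds_iff_eventuallyEq_nhdsNE
      hψ.hasFPowerSeriesAt.continuousAt).1 ?_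
    filter_upwards [self_mem_nhdsWithin, mem_nhdsWithin_of_mem_nhds
      (Metric.ball_mem_nhds (0 : ℂ) one_pos)] with q hq0 hq
    have := im_invQParam_pos_of_norm_lt_one one_pos (mem_ball_zero_iff.1 hq) hq0
    rw [← qParam_right_inv one_ne_zero hq0]
    exact (hφf ⟨_, this⟩).trans (hψf ⟨_, this⟩).symm
  have h2 := hφ.hasFPowerSeriesAt.eq_formalMultilinearSeries
    (hψ.hasFPowerSeriesAt.congr h.symm)
  ext m
  simpa using congr_arg (FormalMultilinearSeries.coeff · m) h2

theorem normalizedDeriv (hf : HasQSeries f F) :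
    HasQSeries (Derivative.normalizedDerivOfComplex f) (qDeriv ℂ F) := by
  obtain ⟨φ, hφ, hφf⟩ := hf.exists_hasFPowerSeriesOnBall
  intro z
  have hz : ‖qParam 1 z‖ < 1 := norm_qParam_lt_one one_pos z.im_pos
  have hball : Metric.eball (0 : ℂ) 1 = Metric.ball 0 1 := by
    rw [← ENNReal.coe_one, Metric.eball_coe, NNReal.coe_one]
  have hd : DifferentiableOn ℂ φ (Metric.ball 0 1) := hball ▸ hφ.differentiableOn
  have hzb : qParam 1 (z : ℂ) ∈ Metric.ball (0 : ℂ) 1 := by simpa using hz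
  have hD : Derivative.normalizedDerivOfComplex f z = qParam 1 z * deriv φ (qParam 1 z) := by
    have h1 : f ∘ ofComplex =ᶠ[𝓝 (z : ℂ)] φ ∘ qParam 1 := by
      filter_upwards [(isOpen_upperHalfPlaneSet).mem_nhds z.im_pos] with w hw
      simp only [Function.comp_apply]
      rw [ofComplex_apply_of_im_pos hw, ← hφf]
    have h2 : HasDerivAt (qParam 1) (qParam 1 z * (2 * Real.pi * Complex.I)) (z : ℂ) := by
      have := ((hasDerivAt_id (z : ℂ)).const_mul (2 * Real.pi * Complex.I)).cexp
      simpa [funext fun w : ℂ => (by simp [qParam] : qParam 1 w = Complex.exp (2 * Real.pi *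
        Complex.I * w))] using this
    have h3 := ((hd.differentiableAt (Metric.isOpen_ball.mem_nhds hzb)).hasDerivAt).comp (z : ℂ) h2
    rw [Derivative.normalizedDerivOfComplex, h1.deriv_eq, h3.deriv]
    field_simp [Complex.two_pi_I_ne_zero]
  rw [hD]
  have hT := (Complex.hasSum_taylorSeries_on_ball (hd.deriv Metric.isOpen_ball) hzb).mul_left
    (qParam 1 z)
  rw [← hasSum_nat_add_iff' 1]
  simp only [Finset.range_one, Finset.sum_singleton, coeff_qDeriv, Nat.cast_zero, zero_mul,
    sub_zero]
  convert! hT using 2 with m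
  have hm : PowerSeries.coeff (m + 1) F = ((m + 1).factorial : ℂ)⁻¹ *
      iteratedDeriv (m + 1) φ 0 := by
    have h1 := hφ.hasFPowerSeriesAt.eq_formalMultilinearSeries
      (AnalyticAt.hasFPowerSeriesAt ⟨_, hφ.hasFPowerSeriesAt⟩)
    have := congr_arg (FormalMultilinearSeries.coeff · (m + 1)) h1
    simpa [div_eq_mul_inv, mul_comm] using this
  rw [hm, iteratedDeriv_succ', Nat.factorial_succ]
  have : (m.factorial : ℂ) ≠ 0 := by exact_mod_cast m.factorial_ne_zero
  have : (m + 1 : ℂ) ≠ 0 := by exact_mod_cast m.succ_ne_zero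
  simp only [sub_zero, smul_eq_mul, pow_succ]
  push_cast
  field_simp

/-- A `q`-series of weight less than `12` for the full modular group vanishes if its constant term
does. -/
theorem eq_zero_of_slash_eq {k : ℕ} (hk : k < 12) (hf : HasQSeries f F)
    (hs : ∀ γ : SL(2, ℤ), f ∣[(k : ℤ)] γ = f) (h0 : PowerSeries.coeff 0 F = 0) : f = 0 := by
  let f' : ModularForm 𝒮ℒ (k : ℤ) :=
    { toFun := f
      slash_action_eq' := fun _ ⟨γ, hγ⟩ => hγ ▸ hs γ
      holo' := hf.mdifferentiable
      bdd_at_cusps' := fun {c} hc => by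
        rw [Subgroup.IsArithmetic.isCusp_iff_isCusp_SL2Z] at hc
        rw [OnePoint.isBoundedAt_iff_forall_SL2Z hc]
        intro γ _
        rw [hs γ]
        exact isBoundedAtImInfty_of_hasSum_qExpansion one_pos hf }
  have hf' : f' = 0 := by
    apply sturm_bound_levelOne_nat
    rw [Nat.div_eq_of_lt hk, Nat.cast_zero, pos_iff_ne_zero, Ne, ← ENat.natCast_zero,
      PowerSeries.order_eq_nat]
    intro h
    apply h.1
    rw [← ModularFormClass.qExpansion_coeff_unique (f := f') one_pos
      (by simp) hf 0, h0]
  exact congrArg DFunLike.coe hf'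

end HasQSeries

/-- The power series `1 + c ∑ σ_k(n) qⁿ`. -/
def sigmaSeries (R : Type*) [CommRing R] (c : ℤ) (k : ℕ) : PowerSeries R :=
  PowerSeries.mk fun m => ((if m = 0 then 1 else c * ArithmeticFunction.sigma k m : ℤ) : R)

theorem map_sigmaSeries {R S : Type*} [CommRing R] [CommRing S] (φ : R →+* S) (c : ℤ)
    (k : ℕ) : PowerSeries.map φ (sigmaSeries R c k) = sigmaSeries S c k := by
  ext m
  simp only [sigmaSeries, PowerSeries.coeff_map, PowerSeries.coeff_mk, map_intCast]

theorem coeff_zero_sigmaSeries (R : Type*) [CommRing R] (c : ℤ) (k : ℕ) :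
    PowerSeries.coeff 0 (sigmaSeries R c k) = 1 := by
  simp [sigmaSeries]

theorem coeff_one_sigmaSeries (R : Type*) [CommRing R] (c : ℤ) (k : ℕ) :
    PowerSeries.coeff 1 (sigmaSeries R c k) = c := by
  simp [sigmaSeries]

theorem hasQSeries_E2 : HasQSeries EisensteinSeries.E2 (sigmaSeries ℂ (-24) 1) := by
  intro z
  convert! EisensteinSeries.hasSum_qExpansion_E2 (z := z) using 2 with m
  · by_cases hm : m = 0 <;> simp [sigmaSeries, hm, qParam]

theorem hasQSeries_E {k : ℕ} (hk : 3 ≤ k) (hk2 : Even k) {c : ℤ}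
    (hc : -(2 * k / bernoulli k : ℚ) = c) :
    HasQSeries (ModularForm.E hk) (sigmaSeries ℂ c (k - 1)) := by
  intro z
  convert! ModularForm.hasSum_qExpansion (ModularForm.E hk) one_pos (by simp) z using 3 with m
  rw [EisensteinSeries.E_qExpansion_coeff hk hk2]
  by_cases hm : m = 0
  · simp [sigmaSeries, hm]
  · have : (-(2 * k / bernoulli k : ℚ) : ℂ) = c := by exact_mod_cast congrArg (Rat.cast : ℚ → ℂ) hc
    simp [sigmaSeries, hm, ← this]

theorem hasQSeries_E₄ : HasQSeries E₄ (sigmaSeries ℂ 240 3) :=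
  hasQSeries_E (by norm_num) ⟨2, rfl⟩ (by
    rw [show bernoulli 4 = -1 / 30 by decide +kernel]; norm_num)

theorem hasQSeries_E₆ : HasQSeries E₆ (sigmaSeries ℂ (-504) 5) :=
  hasQSeries_E (by norm_num) ⟨3, rfl⟩ (by
    rw [show bernoulli 6 = 1 / 42 by decide +kernel]; norm_num)

theorem hasQSeries_zero : HasQSeries 0 0 := fun z => by simp

theorem ModularForm.slash_SL_eq {k : ℤ} (f : ModularForm 𝒮ℒ k) (γ : SL(2, ℤ)) :
    (f : ℍ → ℂ) ∣[k] γ = f :=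
  f.slash_action_eq' _ ⟨γ, rfl⟩

/-- A `q`-series identity of weight less than `12` may be checked on constant terms. -/
theorem HasQSeries.series_eq_zero {f : ℍ → ℂ} {F : PowerSeries ℂ} {k : ℕ} (hk : k < 12)
    (hf : HasQSeries f F) (hs : ∀ γ : SL(2, ℤ), f ∣[(k : ℤ)] γ = f)
    (h0 : PowerSeries.coeff 0 F = 0) : F = 0 := by
  have := hf.eq_zero_of_slash_eq hk hs h0
  subst this
  exact hf.unique hasQSeries_zero

theorem twelve_mul_qDeriv_E₄ :
    12 * qDeriv ℂ (sigmaSeries ℂ 240 3) =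
      4 * (sigmaSeries ℂ (-24) 1 * sigmaSeries ℂ 240 3 - sigmaSeries ℂ (-504) 5) := by
  have h := ((hasQSeries_E₄.normalizedDeriv.const_mul 12).sub
    ((hasQSeries_E2.mul hasQSeries_E₄).const_mul 4)).add (hasQSeries_E₆.const_mul 4)
  have key := h.series_eq_zero (k := 6) (by norm_num) (fun γ => by
    have h4 := Derivative.serreDerivative_slash_invariant hasQSeries_E₄.mdifferentiable
      (ModularForm.slash_SL_eq E₄ γ)
    have h6 := ModularForm.slash_SL_eq E₆ γ
    ext z
    have h4z := congrFun h4 z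
    have h6z := congrFun h6 z
    simp only [SL_slash_apply, Derivative.serreDerivative_apply, Pi.add_apply, Pi.sub_apply,
      Pi.mul_apply] at h4z h6z ⊢
    norm_num at h4z h6z ⊢
    linear_combination 12 * h4z + 4 * h6z) (by
    simp [coeff_qDeriv, -PowerSeries.coeff_zero_eq_constantCoeff, sigmaSeries,
      PowerSeries.coeff_mul])
  simp only [map_ofNat] at key
  linear_combination key

theorem twelve_mul_qDeriv_E₆ :
    12 * qDeriv ℂ (sigmaSeries ℂ (-504) 5) =
      6 * (sigmaSeries ℂ (-24) 1 * sigmaSeries ℂ (-504) 5 - sigmaSeries ℂ 240 3 ^ 2) := by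
  have h := ((hasQSeries_E₆.normalizedDeriv.const_mul 12).sub
    ((hasQSeries_E2.mul hasQSeries_E₆).const_mul 6)).add
      ((hasQSeries_E₄.mul hasQSeries_E₄).const_mul 6)
  have key := h.series_eq_zero (k := 8) (by norm_num) (fun γ => by
    have h6 := Derivative.serreDerivative_slash_invariant hasQSeries_E₆.mdifferentiable
      (ModularForm.slash_SL_eq E₆ γ)
    have h4 := ModularForm.slash_SL_eq E₄ γ
    ext z
    have h6z := congrFun h6 z
    have h4z := congrFun h4 z
    simp only [SL_slash_apply, Derivative.serreDerivative_apply, Pi.add_apply, Pi.sub_apply,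
      Pi.mul_apply] at h4z h6z ⊢
    norm_num at h4z h6z ⊢
    have h4sq := congrArg (· ^ 2) h4z
    linear_combination 12 * h6z + 6 * h4sq) (by
    simp [coeff_qDeriv, -PowerSeries.coeff_zero_eq_constantCoeff, sigmaSeries,
      PowerSeries.coeff_mul])
  simp only [map_ofNat] at key
  linear_combination key

theorem hasDerivAt_div_denom (γ : SL(2, ℤ)) (z : ℍ) :
    HasDerivAt ((fun w : ℍ => (γ 1 0 : ℂ) / denom γ w) ∘ ofComplex)
      (-(γ 1 0 / denom γ z) ^ 2) (z : ℂ) := by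
  have h1 : (fun w : ℍ => (γ 1 0 : ℂ) / denom γ w) ∘ ofComplex =ᶠ[𝓝 (z : ℂ)]
      fun w : ℂ => (γ 1 0 : ℂ) / (γ 1 0 * w + γ 1 1) := by
    filter_upwards [(isOpen_upperHalfPlaneSet).mem_nhds z.im_pos] with w hw
    simp [denom, ofComplex_apply_of_im_pos hw]
  have hd : (γ 1 0 * z + γ 1 1 : ℂ) ≠ 0 := by simpa [denom] using denom_ne_zero γ z
  have h2 := (hasDerivAt_const (z : ℂ) (γ 1 0 : ℂ)).div
    (((hasDerivAt_id (z : ℂ)).const_mul (γ 1 0 : ℂ)).add_const (γ 1 1 : ℂ)) hd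
  refine (h2.congr_of_eventuallyEq h1).congr_deriv ?_
  simp [denom, div_pow]
  ring

theorem twelve_mul_qDeriv_E2 :
    12 * qDeriv ℂ (sigmaSeries ℂ (-24) 1) =
      sigmaSeries ℂ (-24) 1 ^ 2 - sigmaSeries ℂ 240 3 := by
  have h := ((hasQSeries_E2.normalizedDeriv.const_mul 12).sub
    (hasQSeries_E2.mul hasQSeries_E2)).add hasQSeries_E₄
  have key := h.series_eq_zero (k := 4) (by norm_num) (fun γ => by
    have h4 := ModularForm.slash_SL_eq E₄ γ
    have hD := Derivative.normalizedDerivOfComplex_SL_slash (k := 2)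
      hasQSeries_E2.mdifferentiable (γ := γ)
    have hE : EisensteinSeries.E2 ∣[(2 : ℤ)] γ = EisensteinSeries.E2 + fun w : ℍ =>
        12 * (2 * Real.pi * Complex.I)⁻¹ * ((γ 1 0 : ℂ) / denom γ w) := by
      rw [EisensteinSeries.E2_slash_action, sub_eq_add_neg]
      congr 1
      ext w
      have := denom_ne_zero γ w
      simp only [Pi.neg_apply, Pi.smul_apply, EisensteinSeries.D2, riemannZeta_two, smul_eq_mul]
      field_simp
      simp [Complex.I_sq]
      ring
    ext z
    have hDE : Derivative.normalizedDerivOfComplex (EisensteinSeries.E2 ∣[(2 : ℤ)] γ) z =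
        Derivative.normalizedDerivOfComplex EisensteinSeries.E2 z -
          12 * ((2 * Real.pi * Complex.I)⁻¹) ^ 2 * ((γ 1 0 : ℂ) / denom γ z) ^ 2 := by
      have hd1 : DifferentiableAt ℂ (EisensteinSeries.E2 ∘ ofComplex) (z : ℂ) :=
        mdifferentiableAt_iff.1 (hasQSeries_E2.mdifferentiable z)
      have hd2 := (hasDerivAt_div_denom γ z).const_mul (12 * (2 * Real.pi * Complex.I)⁻¹)
      rw [hE]
      simp only [Derivative.normalizedDerivOfComplex]
      have := (hd1.hasDerivAt.add hd2).deriv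
      erw [this]
      ring
    have hDz := congrFun hD z
    have h4z := congrFun h4 z
    have hEz := congrFun hE z
    rw [hDE] at hDz
    simp only [SL_slash_apply, Pi.add_apply, Pi.sub_apply,
      Pi.mul_apply] at h4z hEz hDz ⊢
    norm_num at h4z hEz hDz ⊢
    have hEsq := congrArg (fun x => (x + 12 * (Complex.I * ((Real.pi : ℂ)⁻¹ * (1 / 2))) *
      ((γ 1 0 : ℂ) / denom γ z)) ^ 2) hEz
    linear_combination -12 * hDz + h4z - hEsq) (by
    simp [coeff_qDeriv, -PowerSeries.coeff_zero_eq_constantCoeff, sigmaSeries,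
      PowerSeries.coeff_mul])
  simp only [map_ofNat] at key
  linear_combination key

theorem qDeriv_map {R S : Type*} [CommRing R] [CommRing S] (φ : R →+* S) (F : PowerSeries R) :
    qDeriv S (PowerSeries.map φ F) = PowerSeries.map φ (qDeriv R F) := by
  ext m
  simp [coeff_qDeriv]

/-- Ramanujan's differential equations hold over every commutative ring. -/
theorem isRamanujanTriple_sigmaSeries (R : Type*) [CommRing R] :
    IsRamanujanTriple (sigmaSeries R (-24) 1) (sigmaSeries R 240 3) (sigmaSeries R (-504) 5) := by
  have hinj : Function.Injective (PowerSeries.map (Int.castRingHom ℂ)) :=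
    PowerSeries.map_injective _ (by exact Int.cast_injective)
  have h2 : 12 * qDeriv ℤ (sigmaSeries ℤ (-24) 1) =
      sigmaSeries ℤ (-24) 1 ^ 2 - sigmaSeries ℤ 240 3 := hinj (by
    simp only [map_mul, map_sub, map_pow, map_ofNat, ← qDeriv_map, map_sigmaSeries,
      twelve_mul_qDeriv_E2])
  have h4 : 12 * qDeriv ℤ (sigmaSeries ℤ 240 3) =
      4 * (sigmaSeries ℤ (-24) 1 * sigmaSeries ℤ 240 3 - sigmaSeries ℤ (-504) 5) := hinj (by
    simp only [map_mul, map_sub, map_ofNat, ← qDeriv_map, map_sigmaSeries,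
      twelve_mul_qDeriv_E₄])
  have h6 : 12 * qDeriv ℤ (sigmaSeries ℤ (-504) 5) =
      6 * (sigmaSeries ℤ (-24) 1 * sigmaSeries ℤ (-504) 5 - sigmaSeries ℤ 240 3 ^ 2) := hinj (by
    simp only [map_mul, map_sub, map_pow, map_ofNat, ← qDeriv_map, map_sigmaSeries,
      twelve_mul_qDeriv_E₆])
  refine ⟨?_, ?_, ?_, coeff_zero_sigmaSeries .., coeff_zero_sigmaSeries ..,
    coeff_zero_sigmaSeries .., ?_, ?_⟩
  · simpa only [map_mul, map_sub, map_pow, map_ofNat, ← qDeriv_map, map_sigmaSeries]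
      using congrArg (PowerSeries.map (Int.castRingHom R)) h2
  · simpa only [map_mul, map_sub, map_ofNat, ← qDeriv_map, map_sigmaSeries]
      using congrArg (PowerSeries.map (Int.castRingHom R)) h4
  · simpa only [map_mul, map_sub, map_pow, map_ofNat, ← qDeriv_map, map_sigmaSeries]
      using congrArg (PowerSeries.map (Int.castRingHom R)) h6
  · simp [coeff_one_sigmaSeries]
  · simp [coeff_one_sigmaSeries]

end QSeries

section SeriesSums

/-- The multivariate power series `F` converges to `y` at the point `x`. -/
def HasSeriesSum {σ : Type*} [Fintype σ] (F : MvPowerSeries σ ℂ) (x : σ → ℂ) (y : ℂ) : Prop :=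
  HasSum (fun d : σ →₀ ℕ => MvPowerSeries.coeff d F * ∏ i, x i ^ d i) y

namespace HasSeriesSum

variable {σ : Type*} [Fintype σ] {F G : MvPowerSeries σ ℂ} {x : σ → ℂ} {y z : ℂ}

theorem add (hF : HasSeriesSum F x y) (hG : HasSeriesSum G x z) :
    HasSeriesSum (F + G) x (y + z) := by
  simpa [HasSeriesSum, add_mul] using HasSum.add hF hG

theorem mul (hF : HasSeriesSum F x y) (hG : HasSeriesSum G x z) :
    HasSeriesSum (F * G) x (y * z) := by
  classical
  let a : (σ →₀ ℕ) → ℂ := fun d => MvPowerSeries.coeff d F * ∏ i, x i ^ d i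
  let b : (σ →₀ ℕ) → ℂ := fun d => MvPowerSeries.coeff d G * ∏ i, x i ^ d i
  have ha : HasSum a y := hF
  have hb : HasSum b z := hG
  have hs : Summable fun e : (σ →₀ ℕ) × (σ →₀ ℕ) => a e.1 * b e.2 :=
    summable_mul_of_summable_norm ha.summable.norm hb.summable.norm
  have h := (summable_sum_mul_antidiagonal_of_summable_mul hs).hasSum
  rw [← ha.summable.tsum_mul_tsum_eq_tsum_sum_antidiagonal hb.summable hs, ha.tsum_eq,
    hb.tsum_eq] at h
  have heq : (fun d : σ →₀ ℕ => MvPowerSeries.coeff d (F * G) * ∏ i, x i ^ d i) =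
      fun d => ∑ e ∈ Finset.HasAntidiagonal.antidiagonal d, a e.1 * b e.2 := by
    funext d
    rw [MvPowerSeries.coeff_mul, Finset.sum_mul]
    refine Finset.sum_congr rfl fun e he => ?_
    simp only [a, b]
    rw [← Finset.HasAntidiagonal.mem_antidiagonal.1 he]
    simp only [Finsupp.add_apply, pow_add, Finset.prod_mul_distrib]
    ring
  unfold HasSeriesSum
  rw [heq]
  exact h

theorem const (c : ℂ) : HasSeriesSum (MvPowerSeries.C c) x c := by
  classical
  unfold HasSeriesSum
  convert! hasSum_ite_eq (0 : σ →₀ ℕ) c using 2 with d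
  by_cases hd : d = 0 <;> simp [MvPowerSeries.coeff_C, hd]

/-- Convergence is compatible with polynomial expressions. -/
theorem aeval {τ R : Type*} [CommRing R] (φ : R →+* ℂ) {γ : τ → MvPowerSeries σ R} {g : τ → ℂ}
    (h : ∀ i, HasSeriesSum (MvPowerSeries.map φ (γ i)) x (g i)) (P : MvPolynomial τ R) :
    HasSeriesSum (MvPowerSeries.map φ (MvPolynomial.aeval γ P)) x (P.eval₂ φ g) := by
  induction P using MvPolynomial.induction_on with
  | C a =>
    simpa [MvPowerSeries.algebraMap_apply] using const (φ a)
  | add P Q hP hQ => simpa using hP.add hQ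
  | mul_X P i hP => simpa using hP.mul (h i)

end HasSeriesSum

theorem hasFPowerSeriesOnBall_of_summable {c : ℕ → ℂ}
    (hs : ∀ q : ℝ, 0 < q → q < 1 → Summable fun m => c m * (q : ℂ) ^ m) :
    HasFPowerSeriesOnBall (fun q : ℂ => ∑' m, c m * q ^ m) (.ofScalars ℂ c) 0 1 := by
  have hs' : ∀ q : ℂ, ‖q‖ < 1 → Summable fun m => c m * q ^ m := by
    intro q hq
    rcases eq_or_ne q 0 with rfl | hq0
    · exact summable_of_ne_finset_zero (s := {0}) fun m hm => by
        simp only [Finset.mem_singleton] at hm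
        simp [hm]
    · refine Summable.of_norm ?_
      simpa using (hs ‖q‖ (norm_pos_iff.2 hq0) hq).norm
  refine ⟨le_of_forall_lt_imp_le_of_dense fun r hr => ?_, by simp, fun {y} hy => ?_⟩
  · lift r to NNReal using hr.ne_top
    apply FormalMultilinearSeries.le_radius_of_summable
    simpa [mul_comm] using (hs' (r : ℝ) (by simpa using hr)).norm
  · rw [← ENNReal.coe_one, Metric.eball_coe, NNReal.coe_one, mem_ball_zero_iff] at hy
    simpa [mul_comm] using (hs' y hy).hasSum

open Filter Topology in
/-- A power series vanishing at all real points of `(0, 1)` is zero. -/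
theorem eq_zero_of_hasSum_pow_eq_zero {c : ℕ → ℂ}
    (hc : ∀ q : ℝ, 0 < q → q < 1 → HasSum (fun m => c m * (q : ℂ) ^ m) 0) (m : ℕ) : c m = 0 := by
  have h := hasFPowerSeriesOnBall_of_summable fun q h0 h1 => (hc q h0 h1).summable
  have hfr : ∃ᶠ q : ℂ in 𝓝[≠] 0, ∑' m, c m * q ^ m = 0 := by
    have ht : Tendsto (fun n : ℕ => ((1 / ((n : ℝ) + 2) : ℝ) : ℂ)) atTop (𝓝[≠] 0) := by
      refine tendsto_nhdsWithin_iff.2 ⟨?_, Eventually.of_forall fun n => ?_⟩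
      · have : Tendsto (fun n : ℕ => (1 / ((n : ℝ) + 2) : ℝ)) atTop (𝓝 0) :=
          tendsto_const_nhds.div_atTop (tendsto_atTop_add_const_right _ _
            tendsto_natCast_atTop_atTop)
        exact (Complex.continuous_ofReal.tendsto' 0 0 Complex.ofReal_zero).comp this
      · simp only [Set.mem_compl_iff, Set.mem_singleton_iff, Complex.ofReal_eq_zero]
        positivity
    refine ht.frequently (Frequently.of_forall fun n => (hc _ (by positivity) ?_).tsum_eq)
    rw [div_lt_one (by positivity)]
    linarith [(n.cast_nonneg : (0 : ℝ) ≤ n)]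
  have h0 := h.hasFPowerSeriesAt.eq_zero_of_eventually
    ((h.hasFPowerSeriesAt.analyticAt.frequently_zero_iff_eventually_zero).1 hfr)
  have := congrArg (fun q : FormalMultilinearSeries ℂ ℂ ℂ => q m fun _ => 1) h0
  simpa using this

theorem eq_zero_of_hasSum_prod_pow_eq_zero {n : ℕ} {c : (Fin n → ℕ) → ℂ}
    (hc : ∀ x : Fin n → ℝ, (∀ i, 0 < x i ∧ x i < 1) →
      HasSum (fun d => c d * ∏ i, (x i : ℂ) ^ d i) 0) (d : Fin n → ℕ) : c d = 0 := by
  induction n with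
  | zero =>
    have h := (hc 0 (fun i => i.elim0)).tsum_eq
    rw [tsum_fintype, Fintype.sum_unique] at h
    simp only [Finset.univ_eq_empty, Finset.prod_empty, mul_one] at h
    rwa [Subsingleton.elim d _]
  | succ n ih =>
    have key : ∀ (x : Fin n → ℝ), (∀ i, 0 < x i ∧ x i < 1) → ∀ m : ℕ,
        HasSum (fun e : Fin n → ℕ => c (Fin.cons m e) * ∏ i, (x i : ℂ) ^ e i) 0 := by
      intro x hx
      have hq : ∀ q : ℝ, 0 < q → q < 1 → HasSum (fun p : ℕ × (Fin n → ℕ) =>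
          (c (Fin.cons p.1 p.2) * ∏ i, (x i : ℂ) ^ p.2 i) * (q : ℂ) ^ p.1) 0 := by
        intro q h0 h1
        have h := hc (Fin.cons q x) (fun i => by
          refine Fin.cases ?_ (fun j => ?_) i
          · simpa using ⟨h0, h1⟩
          · simpa using hx j)
        rw [← (Fin.consEquiv fun _ => ℕ).hasSum_iff] at h
        convert! h using 2 with p
        simp [Fin.consEquiv, Fin.prod_univ_succ]
        ring
      have hfib : ∀ m, Summable fun e : Fin n → ℕ =>
          c (Fin.cons m e) * ∏ i, (x i : ℂ) ^ e i := by
        intro m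
        have h := ((hq (1 / 2) (by norm_num) (by norm_num)).summable.prod_factor m).mul_right
          (((1 / 2 : ℝ) : ℂ) ^ m)⁻¹
        refine h.congr fun e => ?_
        have : (((1 / 2 : ℝ) : ℂ) ^ m) ≠ 0 := by norm_num
        field_simp
      have hzero : ∀ m, ∑' e : Fin n → ℕ, c (Fin.cons m e) * ∏ i, (x i : ℂ) ^ e i = 0 := by
        refine eq_zero_of_hasSum_pow_eq_zero fun q h0 h1 => ?_
        have hrow : ∀ m, HasSum (fun e : Fin n → ℕ =>
            (c (Fin.cons m e) * ∏ i, (x i : ℂ) ^ e i) * (q : ℂ) ^ m)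
            ((∑' e : Fin n → ℕ, c (Fin.cons m e) * ∏ i, (x i : ℂ) ^ e i) * (q : ℂ) ^ m) :=
          fun m => (hfib m).hasSum.mul_right _
        exact (hq q h0 h1).prod_fiberwise hrow
      intro m
      have := (hfib m).hasSum
      rwa [hzero m] at this
    have := ih (c := fun e => c (Fin.cons (d 0) e)) (fun x hx => key x hx (d 0)) (Fin.tail d)
    simpa using this

/-- A multivariate power series is determined by its values at real points of the unit cube. -/
theorem HasSeriesSum.ext {n : ℕ} {F G : MvPowerSeries (Fin n) ℂ}
    (h : ∀ x : Fin n → ℝ, (∀ i, 0 < x i ∧ x i < 1) →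
      ∃ y, HasSeriesSum F (fun i => x i) y ∧ HasSeriesSum G (fun i => x i) y) :
    F = G := by
  ext d
  have := eq_zero_of_hasSum_prod_pow_eq_zero
    (c := fun e => MvPowerSeries.coeff (Finsupp.equivFunOnFinite.symm e) F -
      MvPowerSeries.coeff (Finsupp.equivFunOnFinite.symm e) G) (fun x hx => by
      obtain ⟨y, hF, hG⟩ := h x hx
      have h := HasSum.sub hF hG
      rw [sub_self, ← Finsupp.equivFunOnFinite.symm.hasSum_iff] at h
      convert! h using 2 with e
      simp [sub_mul]) (Finsupp.equivFunOnFinite d)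
  simpa [sub_eq_zero] using this

end SeriesSums

section SiegelFourier

/-- The symmetric half-integral matrix `T` with `T₀₀ = d₀`, `T₁₁ = d₁` and
`T₀₀ + 2 T₀₁ + T₁₁ = d₂`. -/
def fourierIndex (d : Fin 3 →₀ ℕ) : Matrix (Fin 2) (Fin 2) ℚ :=
  !![(d 0 : ℚ), ((d 2 : ℚ) - d 0 - d 1) / 2; ((d 2 : ℚ) - d 0 - d 1) / 2, (d 1 : ℚ)]

theorem fourierIndex_injective : Function.Injective fourierIndex := by
  intro d e h
  have h0 : (d 0 : ℚ) = e 0 := by simpa [fourierIndex] using congrFun (congrFun h 0) 0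
  have h1 : (d 1 : ℚ) = e 1 := by simpa [fourierIndex] using congrFun (congrFun h 1) 1
  have h2 : ((d 2 : ℚ) - d 0 - d 1) / 2 = ((e 2 : ℚ) - e 0 - e 1) / 2 := by
    simpa [fourierIndex] using congrFun (congrFun h 0) 1
  ext i
  fin_cases i
  · exact_mod_cast h0
  · exact_mod_cast h1
  · have : (d 2 : ℚ) = e 2 := by linarith
    exact_mod_cast this

theorem fourierIndex_zero : fourierIndex 0 = 0 := by
  ext i j
  fin_cases i <;> fin_cases j <;> simp [fourierIndex]

theorem fourierIndex_add (d e : Fin 3 →₀ ℕ) :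
    fourierIndex (d + e) = fourierIndex d + fourierIndex e := by
  ext i j
  fin_cases i <;> fin_cases j <;> simp [fourierIndex] <;> ring

theorem fourierIndex_mem_siegelLattice {d : Fin 3 →₀ ℕ} :
    fourierIndex d ∈ SiegelLattice 2 1 ↔
      ((fourierIndex d).map (fun q => (q : ℝ))).PosSemidef := by
  refine ⟨fun h => h.2.2.2, fun h => ⟨?_, fun i => ?_, fun i j => ?_, h⟩⟩
  · ext i j
    fin_cases i <;> fin_cases j <;> simp [fourierIndex]
  · fin_cases i
    · exact ⟨d 0, by simp [fourierIndex]⟩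
    · exact ⟨d 1, by simp [fourierIndex]⟩
  · fin_cases i <;> fin_cases j
    · exact ⟨2 * d 0, by simp [fourierIndex]⟩
    · exact ⟨d 2 - d 0 - d 1, by simp [fourierIndex]; ring⟩
    · exact ⟨d 2 - d 0 - d 1, by simp [fourierIndex]; ring⟩
    · exact ⟨2 * d 1, by simp [fourierIndex]⟩

theorem exists_fourierIndex_eq {T : Matrix (Fin 2) (Fin 2) ℚ} (hT : T ∈ SiegelLattice 2 1) :
    ∃ d, fourierIndex d = T := by
  obtain ⟨hsymm, hdiag, hoff, hpsd⟩ := hT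
  obtain ⟨a, ha⟩ := hdiag 0
  obtain ⟨b, hb⟩ := hdiag 1
  obtain ⟨c, hc⟩ := hoff 0 1
  have hs : T 1 0 = T 0 1 := hsymm.apply 0 1
  simp only [Nat.cast_one, one_mul, mul_one] at ha hb hc
  have hnn := fun v => hpsd.dotProduct_mulVec_nonneg v
  have h0 : 0 ≤ a := by
    have := hnn ![1, 0]
    simp [Matrix.mulVec, dotProduct, Fin.sum_univ_two, ha] at this
    exact_mod_cast this
  have h1 : 0 ≤ b := by
    have := hnn ![0, 1]
    simp [Matrix.mulVec, dotProduct, Fin.sum_univ_two, hb] at this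
    exact_mod_cast this
  have h2 : 0 ≤ a + c + b := by
    have := hnn ![1, 1]
    simp [Matrix.mulVec, dotProduct, Fin.sum_univ_two, hb, ha, hs] at this
    have hc' : (2 : ℝ) * (T 0 1 : ℝ) = c := by exact_mod_cast congrArg (fun q : ℚ => (q : ℝ)) hc
    have : (0 : ℝ) ≤ a + c + b := by linarith
    exact_mod_cast this
  lift a to ℕ using h0
  lift b to ℕ using h1
  obtain ⟨e, he⟩ := Int.eq_ofNat_of_zero_le h2
  have he' : (a : ℚ) + c + b = e := by exact_mod_cast he
  refine ⟨Finsupp.equivFunOnFinite.symm ![a, b, e], ?_⟩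
  ext i j
  fin_cases i <;> fin_cases j <;> simp [fourierIndex, ha, hb, hs] <;> linarith

/-- The coordinates `e(Z₀₀ - Z₀₁), e(Z₁₁ - Z₀₁), e(Z₀₁)` in which Fourier expansions are
power series. -/
def siegelPoint (Z : Matrix (Fin 2) (Fin 2) ℂ) : Fin 3 → ℂ :=
  ![exp (2 * Real.pi * I * (Z 0 0 - Z 0 1)), exp (2 * Real.pi * I * (Z 1 1 - Z 0 1)),
    exp (2 * Real.pi * I * Z 0 1)]

theorem exp_trace_fourierIndex (d : Fin 3 →₀ ℕ) {Z : Matrix (Fin 2) (Fin 2) ℂ} (hZ : Z.IsSymm) :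
    exp (2 * Real.pi * I * ((fourierIndex d).map (fun q => (q : ℂ)) * Z).trace) =
      ∏ i, siegelPoint Z i ^ d i := by
  have hs : Z 1 0 = Z 0 1 := hZ.apply 0 1
  simp only [siegelPoint, Fin.prod_univ_three, Matrix.cons_val, ← Complex.exp_nat_mul,
    ← Complex.exp_add]
  congr 1
  simp [Matrix.trace, Matrix.mul_apply, Fin.sum_univ_two, fourierIndex, hs]
  ring

theorem hasSum_siegelLattice_iff {c : Matrix (Fin 2) (Fin 2) ℚ → ℂ}
    (hc : ∀ T, c T ≠ 0 → T ∈ SiegelLattice 2 1) {Z : Matrix (Fin 2) (Fin 2) ℂ} (hZ : Z.IsSymm)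
    {y : ℂ} :
    HasSum (fun T : SiegelLattice 2 1 => c T * exp (2 * Real.pi * I *
      (((T : Matrix (Fin 2) (Fin 2) ℚ).map (fun q => (q : ℂ))) * Z).trace)) y ↔
    HasSeriesSum (fun d => c (fourierIndex d)) (siegelPoint Z) y := by
  have h1 := hasSum_subtype_iff_of_support_subset (a := y) (s := SiegelLattice 2 1)
    (f := fun T : Matrix (Fin 2) (Fin 2) ℚ => c T * exp (2 * Real.pi * I *
      ((T.map (fun q => (q : ℂ))) * Z).trace)) (fun T hT => hc T (left_ne_zero_of_mul hT))
  have h2 := fourierIndex_injective.hasSum_iff (a := y)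
    (f := fun T : Matrix (Fin 2) (Fin 2) ℚ => c T * exp (2 * Real.pi * I *
      ((T.map (fun q => (q : ℂ))) * Z).trace)) (fun T hT => by
        by_contra h
        exact hT (exists_fourierIndex_eq (hc T (left_ne_zero_of_mul h))))
  refine h1.trans (h2.symm.trans ?_)
  unfold HasSeriesSum
  refine iff_of_eq (congrArg (HasSum · y) (funext fun d => ?_))
  simp only [Function.comp_apply, exp_trace_fourierIndex d hZ]
  rfl

namespace SiegelModularForm

variable {k : ℤ} {Γ : Set (Matrix (Fin 2 ⊕ Fin 2) (Fin 2 ⊕ Fin 2) ℤ)}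

/-- The Fourier expansion of a form of degree two as a formal power series. -/
def fourierSeries (f : SiegelModularForm 2 k Γ 1) : MvPowerSeries (Fin 3) ℂ :=
  fun d => f.coeff (fourierIndex d)

theorem coeff_fourierSeries (f : SiegelModularForm 2 k Γ 1) (d : Fin 3 →₀ ℕ) :
    MvPowerSeries.coeff d f.fourierSeries = f.coeff (fourierIndex d) := rfl

theorem hasSeriesSum_fourierSeries (f : SiegelModularForm 2 k Γ 1)
    {Z : Matrix (Fin 2) (Fin 2) ℂ} (hZ : Z ∈ SiegelUpperHalfSpace 2) :
    HasSeriesSum f.fourierSeries (siegelPoint Z) (f.toFun Z) :=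
  (hasSum_siegelLattice_iff f.coeff_supported hZ.1).1 (f.expansion Z hZ)

end SiegelModularForm

theorem mem_siegelUpperHalfSpace_of_pos {r t u : ℝ} (hr : 0 < r) (ht : 0 < t) (hu : 0 ≤ u) (τ : ℂ)
    (hτ : τ.im = r + u) : !![τ, u * I; u * I, (t + u) * I] ∈ SiegelUpperHalfSpace 2 := by
  refine ⟨?_, ?_⟩
  · ext i j
    fin_cases i <;> fin_cases j <;> simp
  have him : ((!![τ, u * I; u * I, (t + u) * I] -
      (!![τ, u * I; u * I, (t + u) * I])ᴴ).map (fun w => w / (2 * Complex.I))) =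
      !![((r + u : ℝ) : ℂ), u; u, ((t + u : ℝ) : ℂ)] := by
    ext i j
    have hτ' := Complex.sub_conj τ
    fin_cases i <;> fin_cases j <;> simp [hτ] at hτ' ⊢
    · rw [hτ']; field_simp
    all_goals field_simp; ring
  rw [him]
  refine Matrix.PosDef.of_dotProduct_mulVec_pos ?_ fun v hv => ?_
  · ext i j
    fin_cases i <;> fin_cases j <;> simp
  have hval : star v ⬝ᵥ (!![((r + u : ℝ) : ℂ), u; u, ((t + u : ℝ) : ℂ)] *ᵥ v) =
      ((r * normSq (v 0) + t * normSq (v 1) + u * normSq (v 0 + v 1) : ℝ) : ℂ) := by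
    simp [Matrix.mulVec, dotProduct, Fin.sum_univ_two, Complex.normSq_eq_conj_mul_self]
    ring
  rw [hval]
  have hpos : 0 < r * normSq (v 0) + t * normSq (v 1) := by
    by_cases h0 : v 0 = 0
    · have h1 : v 1 ≠ 0 := fun h1 => hv (by ext i; fin_cases i <;> simp [h0, h1])
      have := Complex.normSq_pos.2 h1
      have := Complex.normSq_nonneg (v 0)
      positivity
    · have := Complex.normSq_pos.2 h0
      have := Complex.normSq_nonneg (v 1)
      positivity
  have := mul_nonneg hu (Complex.normSq_nonneg (v 0 + v 1))
  exact_mod_cast add_pos_of_pos_of_nonneg hpos this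

theorem exists_siegelPoint_eq {x : Fin 3 → ℝ} (hx : ∀ i, 0 < x i ∧ x i < 1) :
    ∃ Z ∈ SiegelUpperHalfSpace 2, siegelPoint Z = fun i => (x i : ℂ) := by
  have hpos : ∀ i, 0 < -Real.log (x i) / (2 * Real.pi) := fun i =>
    div_pos (neg_pos.2 (Real.log_neg (hx i).1 (hx i).2)) (by positivity)
  have hexp : ∀ i, exp (2 * Real.pi * I * (((-Real.log (x i) / (2 * Real.pi) : ℝ) : ℂ) * I)) =
      x i := by
    intro i
    have : 2 * Real.pi * I * (((-Real.log (x i) / (2 * Real.pi) : ℝ) : ℂ) * I) =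
        (Real.log (x i) : ℂ) := by
      have hpi : (Real.pi : ℂ) ≠ 0 := by exact_mod_cast Real.pi_ne_zero
      push_cast
      field_simp
      simp
    rw [this, ← Complex.ofReal_exp, Real.exp_log (hx i).1]
  set s : Fin 3 → ℝ := fun i => -Real.log (x i) / (2 * Real.pi) with hs
  refine ⟨_, mem_siegelUpperHalfSpace_of_pos (hpos 0) (hpos 1) (hpos 2).le
    (((s 0 + s 2 : ℝ) : ℂ) * I) (by rw [Complex.im_ofReal_mul, I_im, mul_one]), ?_⟩
  ext i
  rw [← hexp i]
  fin_cases i <;> simp [siegelPoint, hs] <;> ring_nf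

end SiegelFourier

section SupportedSeries

/-- The power series whose exponents lie in the submonoid `S`. -/
def supportedSubalgebra {σ : Type*} (R : Type*) [CommRing R] (S : AddSubmonoid (σ →₀ ℕ)) :
    Subalgebra R (MvPowerSeries σ R) where
  carrier := {F | ∀ d, d ∉ S → MvPowerSeries.coeff d F = 0}
  mul_mem' {F G} hF hG d hd := by
    classical
    rw [MvPowerSeries.coeff_mul]
    refine Finset.sum_eq_zero fun e he => ?_
    rw [← Finset.HasAntidiagonal.mem_antidiagonal.1 he] at hd
    by_cases h : e.1 ∈ S
    · rw [hG e.2 fun h' => hd (S.add_mem h h'), mul_zero]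
    · rw [hF e.1 h, zero_mul]
  add_mem' {F G} hF hG d hd := by rw [map_add, hF d hd, hG d hd, add_zero]
  algebraMap_mem' r d hd := by
    classical
    rw [MvPowerSeries.algebraMap_apply, MvPowerSeries.coeff_C, if_neg]
    rintro rfl
    exact hd S.zero_mem

variable {σ R τ : Type*} [CommRing R] {S : AddSubmonoid (σ →₀ ℕ)}

theorem aeval_mem_supportedSubalgebra {γ : τ → MvPowerSeries σ R}
    (hγ : ∀ i, γ i ∈ supportedSubalgebra R S) (P : MvPolynomial τ R) :
    MvPolynomial.aeval γ P ∈ supportedSubalgebra R S := by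
  induction P using MvPolynomial.induction_on with
  | C a => simp
  | add P Q hP hQ => simpa using add_mem hP hQ
  | mul_X P i hP => simpa using mul_mem hP (hγ i)

/-- The restriction of a power series to the ray of exponents `j n`. -/
def rayRestriction (j : ℕ →+ (σ →₀ ℕ)) (F : MvPowerSeries σ R) : PowerSeries R :=
  PowerSeries.mk fun n => MvPowerSeries.coeff (j n) F

/-- Restriction to a face of `S` is multiplicative on series supported on `S`. -/
theorem rayRestriction_mul {j : ℕ →+ (σ →₀ ℕ)} (hj : Function.Injective j)
    (hS : ∀ d ∈ S, ∀ e ∈ S, ∀ n, d + e = j n → d ∈ Set.range j ∧ e ∈ Set.range j)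
    {F G : MvPowerSeries σ R} (hF : F ∈ supportedSubalgebra R S)
    (hG : G ∈ supportedSubalgebra R S) :
    rayRestriction j (F * G) = rayRestriction j F * rayRestriction j G := by
  classical
  ext n
  rw [PowerSeries.coeff_mul]
  simp only [rayRestriction, PowerSeries.coeff_mk, MvPowerSeries.coeff_mul]
  symm
  refine Finset.sum_of_injOn (fun a : ℕ × ℕ => (j a.1, j a.2)) ?_ ?_ ?_ fun a _ => rfl
  · intro a _ b _ hab
    exact Prod.ext (hj (congrArg Prod.fst hab)) (hj (congrArg Prod.snd hab))
  · intro a ha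
    simp only [Finset.mem_coe, Finset.HasAntidiagonal.mem_antidiagonal] at ha ⊢
    rw [← map_add, ha]
  · intro e he hne
    by_contra h
    rw [Finset.HasAntidiagonal.mem_antidiagonal] at he
    obtain ⟨⟨a, ha⟩, ⟨b, hb⟩⟩ := hS e.1 (by_contra fun h' => h (by rw [hF _ h', zero_mul])) e.2
      (by_contra fun h' => h (by rw [hG _ h', mul_zero])) n he
    refine hne ⟨(a, b), ?_, Prod.ext ha hb⟩
    rw [Finset.mem_coe, Finset.HasAntidiagonal.mem_antidiagonal]
    exact hj (by rw [map_add, ha, hb, he])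

theorem rayRestriction_aeval {j : ℕ →+ (σ →₀ ℕ)} (hj : Function.Injective j)
    (hS : ∀ d ∈ S, ∀ e ∈ S, ∀ n, d + e = j n → d ∈ Set.range j ∧ e ∈ Set.range j)
    {γ : τ → MvPowerSeries σ R} (hγ : ∀ i, γ i ∈ supportedSubalgebra R S)
    (P : MvPolynomial τ R) :
    rayRestriction j (MvPolynomial.aeval γ P) =
      MvPolynomial.aeval (fun i => rayRestriction j (γ i)) P := by
  classical
  induction P using MvPolynomial.induction_on with
  | C a =>
    ext n
    have : j n = 0 ↔ n = 0 := by rw [← hj.eq_iff, map_zero]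
    simp [rayRestriction, MvPowerSeries.algebraMap_apply,
      MvPowerSeries.coeff_C, PowerSeries.coeff_C, this]
  | add P Q hP hQ =>
    rw [map_add, map_add, ← hP, ← hQ]
    ext n
    simp [rayRestriction]
  | mul_X P i hP =>
    rw [map_mul, map_mul, rayRestriction_mul hj hS (aeval_mem_supportedSubalgebra hγ P) (by
      simpa using hγ i), hP, MvPolynomial.aeval_X, MvPolynomial.aeval_X]

end SupportedSeries

section SiegelCone

/-- The exponents of power series which are Fourier expansions of Siegel modular forms. -/
def siegelCone : AddSubmonoid (Fin 3 →₀ ℕ) where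
  carrier := {d | fourierIndex d ∈ SiegelLattice 2 1}
  zero_mem' := by
    rw [Set.mem_ofPred_eq, fourierIndex_mem_siegelLattice, fourierIndex_zero]
    have : ((0 : Matrix (Fin 2) (Fin 2) ℚ).map fun q => (q : ℝ)) = 0 := by
      ext i j
      simp
    rw [this]
    exact Matrix.PosSemidef.zero
  add_mem' {d e} hd he := by
    rw [Set.mem_ofPred_eq, fourierIndex_mem_siegelLattice] at hd he ⊢
    have : (fourierIndex (d + e)).map (fun q => (q : ℝ)) =
        (fourierIndex d).map (fun q => (q : ℝ)) + (fourierIndex e).map (fun q => (q : ℝ)) := by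
      rw [fourierIndex_add]
      ext i j
      simp
    rw [this]
    exact hd.add he

/-- The exponents of the Fourier index `diag(n, 0)`. -/
def siegelRay : ℕ →+ (Fin 3 →₀ ℕ) :=
  Finsupp.singleAddHom 0 + Finsupp.singleAddHom 2

theorem siegelRay_apply (n : ℕ) :
    siegelRay n = Finsupp.single 0 n + Finsupp.single 2 n := rfl

theorem siegelRay_injective : Function.Injective siegelRay := by
  intro m n h
  simpa [siegelRay_apply] using DFunLike.congr_fun h 0

theorem eq_siegelRay_of_mem_siegelCone {d : Fin 3 →₀ ℕ} (hd : d ∈ siegelCone) (h1 : d 1 = 0) :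
    d = siegelRay (d 0) := by
  have hdet := (fourierIndex_mem_siegelLattice.1 hd).det_nonneg
  simp [Matrix.det_fin_two, fourierIndex, h1] at hdet
  have h : ((d 2 : ℝ) - d 0) = 0 := by nlinarith [sq_nonneg ((d 2 : ℝ) - d 0)]
  have h2 : d 2 = d 0 := by exact_mod_cast sub_eq_zero.1 h
  ext i
  fin_cases i <;> simp [siegelRay_apply, h1, h2]

theorem mem_range_siegelRay_of_add {d : Fin 3 →₀ ℕ} (hd : d ∈ siegelCone) {e : Fin 3 →₀ ℕ}
    (he : e ∈ siegelCone) {n : ℕ} (h : d + e = siegelRay n) :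
    d ∈ Set.range siegelRay ∧ e ∈ Set.range siegelRay := by
  have h1 : d 1 + e 1 = 0 := by simpa [siegelRay_apply] using DFunLike.congr_fun h 1
  exact ⟨⟨_, (eq_siegelRay_of_mem_siegelCone hd (by omega)).symm⟩,
    ⟨_, (eq_siegelRay_of_mem_siegelCone he (by omega)).symm⟩⟩

theorem not_posDef_fourierIndex_siegelRay (n : ℕ) :
    ¬ ((fourierIndex (siegelRay n)).map (fun q => (q : ℝ))).PosDef := by
  intro h
  have := h.det_pos
  simp [Matrix.det_fin_two, fourierIndex, siegelRay_apply] at this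

theorem SiegelModularForm.fourierSeries_mem {k : ℤ}
    {Γ : Set (Matrix (Fin 2 ⊕ Fin 2) (Fin 2 ⊕ Fin 2) ℤ)} (f : SiegelModularForm 2 k Γ 1) :
    f.fourierSeries ∈ supportedSubalgebra ℂ siegelCone :=
  fun _ hd => by_contra fun h => hd (f.coeff_supported _ h)

end SiegelCone

section PIntegers

/-- The ring of `p`-integral rational numbers. -/
def pIntegers (p : ℕ) [Fact p.Prime] : Subring ℚ where
  carrier := {q | (q.den : ZMod p) ≠ 0}
  mul_mem' {q r} hq hr h := by
    refine mul_ne_zero hq hr ?_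
    rw [ZMod.natCast_eq_zero_iff] at h
    rw [← Nat.cast_mul, ZMod.natCast_eq_zero_iff]
    exact h.trans (Rat.mul_den_dvd q r)
  one_mem' := by simp
  add_mem' {q r} hq hr h := by
    refine mul_ne_zero hq hr ?_
    rw [ZMod.natCast_eq_zero_iff] at h
    rw [← Nat.cast_mul, ZMod.natCast_eq_zero_iff]
    exact h.trans (Rat.add_den_dvd q r)
  zero_mem' := by simp
  neg_mem' {q} hq := by simpa using hq

variable {p : ℕ} [Fact p.Prime]

theorem mem_pIntegers_iff {q : ℚ} :
    q ∈ pIntegers p ↔ ∃ a b : ℤ, ¬ (p : ℤ) ∣ b ∧ (b : ℚ) * q = a := by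
  change (q.den : ZMod p) ≠ 0 ↔ _
  rw [Ne, ZMod.natCast_eq_zero_iff]
  constructor
  · intro h
    exact ⟨q.num, q.den, by rwa [Int.natCast_dvd_natCast], by
      rw [Int.cast_natCast, mul_comm, Rat.mul_den_eq_num]⟩
  · rintro ⟨a, b, hb, h⟩ hq
    have hb0 : (b : ℚ) ≠ 0 := by
      rintro h0
      exact hb (by rw [Int.cast_eq_zero.1 h0]; exact dvd_zero _)
    rw [mul_comm, ← eq_div_iff hb0] at h
    refine hb ((Int.natCast_dvd_natCast.2 hq).trans ?_)
    rw [h, ← Rat.divInt_eq_div]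
    exact Rat.den_dvd a b

/-- Reduction modulo `p`. -/
def pIntegersMod (p : ℕ) [Fact p.Prime] : pIntegers p →+* ZMod p where
  toFun q := ((q : ℚ) : ZMod p)
  map_one' := by simp
  map_mul' q r := Rat.cast_mul_of_ne_zero q.2 r.2
  map_zero' := by simp
  map_add' q r := Rat.cast_add_of_ne_zero q.2 r.2

/-- The embedding of the `p`-integral rational numbers into `ℂ`. -/
def pIntegersToComplex (p : ℕ) [Fact p.Prime] : pIntegers p →+* ℂ :=
  (algebraMap ℚ ℂ).comp (pIntegers p).subtype

theorem pIntegersToComplex_apply (q : pIntegers p) : pIntegersToComplex p q = ((q : ℚ) : ℂ) := rfl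

theorem pIntegersToComplex_injective : Function.Injective (pIntegersToComplex p) :=
  (algebraMap ℚ ℂ).injective.comp Subtype.val_injective

theorem pIntegersMod_surjective : Function.Surjective (pIntegersMod p) := fun a =>
  ⟨(a.val : pIntegers p), by rw [map_natCast, ZMod.natCast_val, ZMod.cast_id]⟩

theorem pIntegersMod_eq_zero_iff {q : pIntegers p} :
    pIntegersMod p q = 0 ↔ ∃ r : pIntegers p, q = p * r := by
  have hp0 : (p : ℚ) ≠ 0 := Nat.cast_ne_zero.2 (Fact.out : p.Prime).ne_zero
  constructor
  · intro h
    have h' : ((q : ℚ).num : ZMod p) / ((q : ℚ).den : ZMod p) = 0 := by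
      rw [← Rat.cast_def]
      exact h
    obtain ⟨m, hm⟩ := (ZMod.intCast_zmod_eq_zero_iff_dvd _ p).1
      ((div_eq_zero_iff.1 h').resolve_right q.2)
    refine ⟨⟨(q : ℚ) / p, mem_pIntegers_iff.2 ⟨m, (q : ℚ).den, ?_, ?_⟩⟩, ?_⟩
    · rw [Int.natCast_dvd_natCast, ← ZMod.natCast_eq_zero_iff]
      exact q.2
    · rw [Int.cast_natCast, ← mul_div_assoc, mul_comm, Rat.mul_den_eq_num, hm]
      push_cast
      field_simp
    · ext
      push_cast
      field_simp
  · rintro ⟨r, rfl⟩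
    simp

theorem isPIntegral_iff {z : ℂ} :
    IsPIntegral p z ↔ ∃ q : pIntegers p, pIntegersToComplex p q = z := by
  constructor
  · rintro ⟨a, b, hb, h⟩
    have hb0 : (b : ℚ) ≠ 0 := by
      rintro h0
      exact hb (by rw [Int.cast_eq_zero.1 h0]; exact dvd_zero _)
    refine ⟨⟨a / b, mem_pIntegers_iff.2 ⟨a, b, hb, by field_simp⟩⟩, ?_⟩
    have hb0' : (b : ℂ) ≠ 0 := by exact_mod_cast hb0
    rw [pIntegersToComplex_apply, Rat.cast_div, Rat.cast_intCast, Rat.cast_intCast,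
      div_eq_iff hb0', mul_comm, h]
  · rintro ⟨q, rfl⟩
    obtain ⟨a, b, hb, h⟩ := mem_pIntegers_iff.1 q.2
    exact ⟨a, b, hb, by rw [pIntegersToComplex_apply]; exact_mod_cast h⟩

theorem isPIntegral_ratCast_iff {q : ℚ} : IsPIntegral p (q : ℂ) ↔ q ∈ pIntegers p := by
  rw [isPIntegral_iff]
  constructor
  · rintro ⟨r, hr⟩
    rw [pIntegersToComplex_apply, Rat.cast_inj] at hr
    exact hr ▸ r.2
  · exact fun h => ⟨⟨q, h⟩, rfl⟩

theorem modCongr_iff {q r : pIntegers p} :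
    ModCongr p 1 (pIntegersToComplex p q) (pIntegersToComplex p r) ↔
      pIntegersMod p q = pIntegersMod p r := by
  have hp0 : (p : ℂ) ≠ 0 := Nat.cast_ne_zero.2 (Fact.out : p.Prime).ne_zero
  rw [← sub_eq_zero, ← map_sub, pIntegersMod_eq_zero_iff, ModCongr, isPIntegral_iff, pow_one,
    ← map_sub]
  refine exists_congr fun s => ?_
  rw [eq_div_iff hp0, ← map_natCast (pIntegersToComplex p), ← map_mul,
    pIntegersToComplex_injective.eq_iff, mul_comm, eq_comm]

theorem modCongr_zero_iff {q : pIntegers p} :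
    ModCongr p 1 (pIntegersToComplex p q) 0 ↔ pIntegersMod p q = 0 := by
  rw [← map_zero (pIntegersToComplex p), modCongr_iff, map_zero]

theorem exists_map_eq_of_isPIntegral {σ : Type*} {P : MvPolynomial σ ℚ}
    (hP : ∀ m, IsPIntegral p ((P.coeff m : ℚ) : ℂ)) :
    ∃ P' : MvPolynomial σ (pIntegers p), P'.map (pIntegers p).subtype = P := by
  refine (MvPolynomial.mem_range_map_iff_coeffs_subset (f := (pIntegers p).subtype)).2 ?_
  intro q hq
  obtain ⟨m, -, rfl⟩ := MvPolynomial.mem_coeffs_iff.1 hq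
  exact ⟨⟨_, isPIntegral_ratCast_iff.1 (hP m)⟩, rfl⟩

theorem exists_map_eq_of_isPIntegral_coeff {σ : Type*} {F : MvPowerSeries σ ℂ}
    (hF : ∀ d, IsPIntegral p (MvPowerSeries.coeff d F)) :
    ∃ F' : MvPowerSeries σ (pIntegers p), MvPowerSeries.map (pIntegersToComplex p) F' = F := by
  choose c hc using fun d => isPIntegral_iff.1 (hF d)
  exact ⟨c, by ext d; exact hc d⟩

/-- A weighted homogeneous polynomial lifts along reduction modulo `p`. -/
theorem exists_isWeightedHomogeneous_map_eq {σ : Type*} {w : σ → ℕ} {n : ℕ}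
    {f : MvPolynomial σ (ZMod p)} (hf : f.IsWeightedHomogeneous w n) :
    ∃ g : MvPolynomial σ (pIntegers p), g.IsWeightedHomogeneous w n ∧
      g.map (pIntegersMod p) = f := by
  choose s hs using pIntegersMod_surjective (p := p)
  refine ⟨∑ d ∈ f.support, MvPolynomial.monomial d (s (f.coeff d)), ?_, ?_⟩
  · exact MvPolynomial.IsWeightedHomogeneous.sum _ _ _ fun d hd =>
      MvPolynomial.isWeightedHomogeneous_monomial _ _ _ (hf (MvPolynomial.mem_support_iff.1 hd))
  · conv_rhs => rw [f.as_sum]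
    simp only [map_sum, MvPolynomial.map_monomial, hs]

end PIntegers

section IsobaricPolynomials

theorem MvPolynomial.IsWeightedHomogeneous.eval₂_mul_pow {σ R S : Type*} [Fintype σ] [CommRing R]
    [CommRing S] {w : σ → ℕ} {n : ℕ} {P : MvPolynomial σ R} (hP : P.IsWeightedHomogeneous w n)
    (φ : R →+* S) (c : S) (g : σ → S) :
    P.eval₂ φ (fun i => c ^ w i * g i) = c ^ n * P.eval₂ φ g := by
  rw [MvPolynomial.eval₂_eq', MvPolynomial.eval₂_eq', Finset.mul_sum]
  refine Finset.sum_congr rfl fun d hd => ?_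
  rw [← hP (MvPolynomial.mem_support_iff.1 hd), Finsupp.weight_apply,
    Finsupp.sum_fintype _ _ (by simp)]
  simp only [mul_pow, Finset.prod_mul_distrib, smul_eq_mul, ← pow_mul, mul_comm (w _),
    Finset.prod_pow_eq_pow_sum]
  ring

namespace SiegelModularForm

variable {R τ : Type*} [CommRing R]
  {Γ : Set (Matrix (Fin 2 ⊕ Fin 2) (Fin 2 ⊕ Fin 2) ℤ)}

theorem map_aeval_mem_supportedSubalgebra {w : τ → ℤ} {φ : R →+* ℂ}
    (G : ∀ i, SiegelModularForm 2 (w i) Γ 1) {γ : τ → MvPowerSeries (Fin 3) R}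
    (hγ : ∀ i, MvPowerSeries.map φ (γ i) = (G i).fourierSeries) (P : MvPolynomial τ R) :
    MvPowerSeries.map φ (MvPolynomial.aeval γ P) ∈ supportedSubalgebra ℂ siegelCone := by
  induction P using MvPolynomial.induction_on with
  | C a =>
    simpa [MvPowerSeries.algebraMap_apply] using
      (supportedSubalgebra ℂ siegelCone).algebraMap_mem (φ a)
  | add P Q hP hQ => simpa using add_mem hP hQ
  | mul_X P i hP => simpa [hγ] using mul_mem hP (G i).fourierSeries_mem

/-- A scalar multiple of an isobaric polynomial in Siegel modular forms is a Siegel modular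
form. -/
theorem exists_eq_const_mul_eval₂ [Fintype τ] {w : τ → ℕ} {φ : R →+* ℂ}
    (G : ∀ i, SiegelModularForm 2 (w i : ℤ) Γ 1) {γ : τ → MvPowerSeries (Fin 3) R}
    (hγ : ∀ i, MvPowerSeries.map φ (γ i) = (G i).fourierSeries) {P : MvPolynomial τ R} {n : ℕ}
    (hP : P.IsWeightedHomogeneous w n) (r : ℂ) :
    ∃ f : SiegelModularForm 2 (n : ℤ) Γ 1,
      (∀ Z, f.toFun Z = r * P.eval₂ φ fun i => (G i).toFun Z) ∧
      f.coeff = Function.extend fourierIndex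
        (fun d => r * φ (MvPowerSeries.coeff d (MvPolynomial.aeval γ P))) 0 := by
  have hsupp : ∀ T, Function.extend fourierIndex
      (fun d => r * φ (MvPowerSeries.coeff d (MvPolynomial.aeval γ P))) 0 T ≠ 0 →
      T ∈ SiegelLattice 2 1 := by
    intro T hT
    by_cases h : ∃ d, fourierIndex d = T
    · obtain ⟨d, rfl⟩ := h
      rw [fourierIndex_injective.extend_apply] at hT
      by_contra hd
      have := map_aeval_mem_supportedSubalgebra G hγ P d hd
      rw [MvPowerSeries.coeff_map] at this
      exact hT (by rw [this, mul_zero])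
    · exact absurd (Function.extend_apply' _ _ _ h) hT
  refine ⟨⟨fun Z => r * P.eval₂ φ fun i => (G i).toFun Z, _, ?_, ?_, hsupp, ?_⟩,
    fun Z => rfl, rfl⟩
  · refine DifferentiableOn.const_mul ?_ _
    clear hP hsupp
    induction P using MvPolynomial.induction_on with
    | C a => simp
    | add P Q hP hQ => simpa using hP.fun_add hQ
    | mul_X P i hP => simpa using hP.fun_mul (G i).holo
  · intro M hM Z hZ
    simp only [(G _).transform M hM Z hZ, zpow_natCast]
    rw [hP.eval₂_mul_pow]
    ring
  · intro Z hZ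
    rw [hasSum_siegelLattice_iff hsupp hZ.1]
    have h := HasSum.mul_left r (HasSeriesSum.aeval φ
      (fun i => by rw [hγ i]; exact (G i).hasSeriesSum_fourierSeries hZ) P)
    unfold HasSeriesSum
    convert! h using 2 with d
    rw [← mul_assoc, MvPowerSeries.coeff_map]
    congr 1
    exact fourierIndex_injective.extend_apply
      (fun d => r * φ (MvPowerSeries.coeff d (MvPolynomial.aeval γ P))) 0 d

theorem fourierSeries_eq_map_aeval {w : τ → ℤ} {φ : R →+* ℂ}
    (G : ∀ i, SiegelModularForm 2 (w i) Γ 1) {γ : τ → MvPowerSeries (Fin 3) R}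
    (hγ : ∀ i, MvPowerSeries.map φ (γ i) = (G i).fourierSeries) {P : MvPolynomial τ R} {k : ℤ}
    {f : SiegelModularForm 2 k Γ 1}
    (hf : ∀ Z ∈ SiegelUpperHalfSpace 2, f.toFun Z = P.eval₂ φ fun i => (G i).toFun Z) :
    f.fourierSeries = MvPowerSeries.map φ (MvPolynomial.aeval γ P) := by
  refine HasSeriesSum.ext fun x hx => ?_
  obtain ⟨Z, hZ, hZx⟩ := exists_siegelPoint_eq hx
  rw [← hZx]
  refine ⟨f.toFun Z, f.hasSeriesSum_fourierSeries hZ, ?_⟩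
  rw [hf Z hZ]
  exact HasSeriesSum.aeval φ
    (fun i => by rw [hγ i]; exact (G i).hasSeriesSum_fourierSeries hZ) P

end SiegelModularForm

end IsobaricPolynomials

section SiegelPhi

open UpperHalfPlane ModularForm Function.Periodic
open scoped MatrixGroups

/-- The embedding of `SL₂(ℤ)` into the Siegel modular group acting on the first diagonal entry. -/
def siegelEmbedding (γ : SL(2, ℤ)) : Matrix (Fin 2 ⊕ Fin 2) (Fin 2 ⊕ Fin 2) ℤ :=
  Matrix.fromBlocks !![γ 0 0, 0; 0, 1] !![γ 0 1, 0; 0, 0] !![γ 1 0, 0; 0, 0] !![γ 1 1, 0; 0, 1]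

theorem siegelEmbedding_mem (γ : SL(2, ℤ)) : siegelEmbedding γ ∈ SiegelModularGroup 2 := by
  have hdet : γ 0 0 * γ 1 1 - γ 0 1 * γ 1 0 = 1 := by
    rw [← Matrix.det_fin_two]
    exact γ.2
  change _ = _
  rw [siegelEmbedding, Jn, Matrix.fromBlocks_transpose, Matrix.fromBlocks_multiply,
    Matrix.fromBlocks_multiply, Matrix.fromBlocks_inj]
  refine ⟨?_, ?_, ?_, ?_⟩ <;> ext i j <;> fin_cases i <;> fin_cases j <;>
    simp [Matrix.mul_apply, Fin.sum_univ_two] <;> linarith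

/-- The point `diag(τ, i t)` of the Siegel upper half-space. -/
def siegelDiagonal (t : ℝ) (τ : ℂ) : Matrix (Fin 2) (Fin 2) ℂ := !![τ, 0; 0, t * Complex.I]

theorem siegelDiagonal_mem {t : ℝ} (ht : 0 < t) (z : ℍ) :
    siegelDiagonal t z ∈ SiegelUpperHalfSpace 2 := by
  simpa [siegelDiagonal] using
    mem_siegelUpperHalfSpace_of_pos z.im_pos ht le_rfl z (by simp)

theorem siegelPoint_siegelDiagonal (t : ℝ) (τ : ℂ) :
    siegelPoint (siegelDiagonal t τ) =
      ![qParam 1 τ, ((Real.exp (-(2 * Real.pi * t)) : ℝ) : ℂ), 1] := by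
  ext i
  fin_cases i
  · simp [siegelPoint, siegelDiagonal, qParam]
  · simp only [siegelPoint, siegelDiagonal]
    simp
    congr 1
    linear_combination (2 * Real.pi * t : ℂ) * Complex.I_sq
  · simp [siegelPoint, siegelDiagonal]

theorem siegelDenom_siegelDiagonal (γ : SL(2, ℤ)) (t : ℝ) (z : ℍ) :
    ((siegelEmbedding γ).map (fun a => (a : ℂ))).toBlocks₂₁ * siegelDiagonal t z +
      ((siegelEmbedding γ).map (fun a => (a : ℂ))).toBlocks₂₂ = !![denom γ z, 0; 0, 1] := by
  rw [ModularGroup.denom_apply]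
  ext i j
  fin_cases i <;> fin_cases j <;>
    simp [siegelEmbedding, siegelDiagonal, Matrix.mul_apply, Fin.sum_univ_two,
      Matrix.toBlocks₂₁, Matrix.toBlocks₂₂]

theorem matActS_siegelDiagonal (γ : SL(2, ℤ)) (t : ℝ) (z : ℍ) :
    matActS (siegelEmbedding γ) (siegelDiagonal t z) =
      siegelDiagonal t (γ • z : ℍ) := by
  have hden : (γ 1 0 : ℂ) * z + γ 1 1 ≠ 0 := by
    rw [← ModularGroup.denom_apply]
    exact denom_ne_zero _ z
  have hnum : ((siegelEmbedding γ).map (fun a => (a : ℂ))).toBlocks₁₁ * siegelDiagonal t z +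
      ((siegelEmbedding γ).map (fun a => (a : ℂ))).toBlocks₁₂ =
      siegelDiagonal t (γ • z : ℍ) * !![denom γ z, 0; 0, 1] := by
    rw [ModularGroup.denom_apply, UpperHalfPlane.specialLinearGroup_apply]
    ext i j
    fin_cases i <;> fin_cases j <;>
      simp [siegelEmbedding, siegelDiagonal, Matrix.mul_apply, Fin.sum_univ_two,
        Matrix.toBlocks₁₁, Matrix.toBlocks₁₂]
    rw [div_mul_cancel₀ _ hden]
  rw [matActS, hnum, siegelDenom_siegelDiagonal, Matrix.mul_nonsing_inv_cancel_right]
  simp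

theorem SiegelModularForm.slash_siegelDiagonal {k : ℤ}
    (f : SiegelModularForm 2 k (SiegelModularGroup 2) 1) {t : ℝ} (ht : 0 < t) (γ : SL(2, ℤ)) :
    (fun z : ℍ => f.toFun (siegelDiagonal t z)) ∣[k] γ =
      fun z : ℍ => f.toFun (siegelDiagonal t z) := by
  ext z
  rw [SL_slash_apply, ← matActS_siegelDiagonal,
    f.transform _ (siegelEmbedding_mem γ) _ (siegelDiagonal_mem ht z), siegelDenom_siegelDiagonal,
    Matrix.det_fin_two_of, mul_one, mul_zero, sub_zero, _root_.zpow_neg, mul_assoc, mul_comm,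
    mul_assoc, inv_mul_cancel₀ (zpow_ne_zero _ (denom_ne_zero _ z)), mul_one]

/-- Exponents on three variables as triples. -/
def tripleEquiv : ℕ × ℕ × ℕ ≃ (Fin 3 →₀ ℕ) where
  toFun a := Finsupp.equivFunOnFinite.symm ![a.1, a.2.1, a.2.2]
  invFun d := (d 0, d 1, d 2)
  left_inv a := by simp
  right_inv d := by
    ext i
    fin_cases i <;> simp

theorem tripleEquiv_siegelRay (n : ℕ) : tripleEquiv (n, 0, n) = siegelRay n := by
  ext i
  fin_cases i <;> simp [tripleEquiv, siegelRay_apply]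

namespace SiegelModularForm

variable {k : ℤ} {Γ : Set (Matrix (Fin 2 ⊕ Fin 2) (Fin 2 ⊕ Fin 2) ℤ)}

theorem hasSum_siegelDiagonal (f : SiegelModularForm 2 k Γ 1) {t : ℝ} (ht : 0 < t) (z : ℍ) :
    HasSum (fun a : ℕ × ℕ × ℕ => MvPowerSeries.coeff (tripleEquiv a) f.fourierSeries *
      ((Real.exp (-(2 * Real.pi * t)) : ℝ) : ℂ) ^ a.2.1 * qParam 1 z ^ a.1)
      (f.toFun (siegelDiagonal t z)) := by
  have h := f.hasSeriesSum_fourierSeries (siegelDiagonal_mem ht z)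
  rw [HasSeriesSum, siegelPoint_siegelDiagonal, ← tripleEquiv.hasSum_iff] at h
  convert! h using 2 with a
  simp [tripleEquiv, Fin.prod_univ_three]
  ring

theorem summable_siegelDiagonal (f : SiegelModularForm 2 k Γ 1) (n : ℕ) {t : ℝ} (ht : 0 < t) :
    Summable fun a : ℕ × ℕ => MvPowerSeries.coeff (tripleEquiv (n, a)) f.fourierSeries *
      ((Real.exp (-(2 * Real.pi * t)) : ℝ) : ℂ) ^ a.1 := by
  have h := ((f.hasSum_siegelDiagonal ht UpperHalfPlane.I).summable.prod_factor n).mul_right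
    (qParam 1 UpperHalfPlane.I ^ n)⁻¹
  refine h.congr fun a => ?_
  rw [mul_assoc, mul_inv_cancel₀ (pow_ne_zero _ (qParam_ne_zero _)), mul_one]

theorem hasQSeries_siegelDiagonal (f : SiegelModularForm 2 k Γ 1) {t : ℝ} (ht : 0 < t) :
    HasQSeries (fun z => f.toFun (siegelDiagonal t z)) (PowerSeries.mk fun n =>
      ∑' a : ℕ × ℕ, MvPowerSeries.coeff (tripleEquiv (n, a)) f.fourierSeries *
        ((Real.exp (-(2 * Real.pi * t)) : ℝ) : ℂ) ^ a.1) := by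
  intro z
  simp only [PowerSeries.coeff_mk]
  have hrow : ∀ n, HasSum (fun a : ℕ × ℕ =>
      MvPowerSeries.coeff (tripleEquiv (n, a)) f.fourierSeries *
        ((Real.exp (-(2 * Real.pi * t)) : ℝ) : ℂ) ^ a.1 * qParam 1 z ^ n)
      ((∑' a : ℕ × ℕ, MvPowerSeries.coeff (tripleEquiv (n, a)) f.fourierSeries *
        ((Real.exp (-(2 * Real.pi * t)) : ℝ) : ℂ) ^ a.1) * qParam 1 z ^ n) :=
    fun n => (f.summable_siegelDiagonal n ht).hasSum.mul_right _
  exact (f.hasSum_siegelDiagonal ht z).prod_fiberwise hrow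

theorem hasSum_coeff_tripleEquiv_zero (f : SiegelModularForm 2 k Γ 1) (n : ℕ) :
    HasSum (fun l : ℕ => MvPowerSeries.coeff (tripleEquiv (n, 0, l)) f.fourierSeries)
      (f.coeff (fourierIndex (siegelRay n))) := by
  rw [← coeff_fourierSeries, ← tripleEquiv_siegelRay]
  refine hasSum_single n fun l hl => ?_
  by_contra h
  have hc : tripleEquiv (n, 0, l) ∈ siegelCone := f.coeff_supported _ h
  have := DFunLike.congr_fun (eq_siegelRay_of_mem_siegelCone hc (by simp [tripleEquiv])) 2
  simp [tripleEquiv, siegelRay_apply] at this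
  exact hl this

/-- The image of a form of small weight under the Siegel operator is a multiple of the Eisenstein
series. -/
theorem coeff_siegelRay {k : ℕ} (hk : k < 12)
    (f : SiegelModularForm 2 (k : ℤ) (SiegelModularGroup 2) 1) {E : ℍ → ℂ} {e : PowerSeries ℂ}
    (hE : HasQSeries E e) (hslash : ∀ γ : SL(2, ℤ), E ∣[(k : ℤ)] γ = E)
    (he : PowerSeries.coeff 0 e = 1) (n : ℕ) :
    f.coeff (fourierIndex (siegelRay n)) = PowerSeries.coeff n e * f.coeff 0 := by
  have hrow : ∀ t : ℝ, 0 < t → HasSum (fun a : ℕ × ℕ =>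
      (MvPowerSeries.coeff (tripleEquiv (n, a)) f.fourierSeries - PowerSeries.coeff n e *
        MvPowerSeries.coeff (tripleEquiv (0, a)) f.fourierSeries) *
        ((Real.exp (-(2 * Real.pi * t)) : ℝ) : ℂ) ^ a.1) 0 := by
    intro t ht
    set b : ℕ → ℂ := fun n => ∑' a : ℕ × ℕ, MvPowerSeries.coeff (tripleEquiv (n, a))
      f.fourierSeries * ((Real.exp (-(2 * Real.pi * t)) : ℝ) : ℂ) ^ a.1 with hb
    have hq := (f.hasQSeries_siegelDiagonal ht).sub (hE.const_mul (b 0))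
    have hz := hq.series_eq_zero hk (fun γ => by
      ext z
      have h1 := congrFun (f.slash_siegelDiagonal ht γ) z
      have h2 := congrFun (hslash γ) z
      rw [SL_slash_apply] at h1 h2 ⊢
      simp only [Pi.sub_apply, sub_mul, mul_assoc, h1, h2]) (by
      rw [map_sub, PowerSeries.coeff_mk, PowerSeries.coeff_C_mul, he, mul_one, sub_self])
    have hn := congrArg (PowerSeries.coeff n) hz
    rw [map_sub, PowerSeries.coeff_mk, PowerSeries.coeff_C_mul, map_zero] at hn
    have hs := (f.summable_siegelDiagonal n ht).hasSum.sub
      ((f.summable_siegelDiagonal 0 ht).hasSum.mul_left (PowerSeries.coeff n e))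
    rw [mul_comm (b 0)] at hn
    rw [show _ - _ = (0 : ℂ) from hn] at hs
    convert! hs using 2 with a
    ring
  set D : ℕ → ℕ → ℂ := fun m l =>
    MvPowerSeries.coeff (tripleEquiv (n, m, l)) f.fourierSeries -
      PowerSeries.coeff n e * MvPowerSeries.coeff (tripleEquiv (0, m, l)) f.fourierSeries with hD
  have hcol : ∀ m, ∑' l, D m l = 0 := by
    refine eq_zero_of_hasSum_pow_eq_zero fun q h0 h1 => ?_
    have hexp : Real.exp (-(2 * Real.pi * (-Real.log q / (2 * Real.pi)))) = q := by
      rw [mul_div_cancel₀ _ (by positivity), neg_neg, Real.exp_log h0]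
    have h := hrow (-Real.log q / (2 * Real.pi))
      (div_pos (neg_pos.2 (Real.log_neg h0 h1)) (by positivity))
    rw [hexp] at h
    have h' : HasSum (fun a : ℕ × ℕ => D a.1 a.2 * (q : ℂ) ^ a.1) 0 := h
    have hsum : ∀ m, HasSum (fun l => D m l * (q : ℂ) ^ m) ((∑' l, D m l) * (q : ℂ) ^ m) := by
      intro m
      refine HasSum.mul_right _ (Summable.hasSum ?_)
      refine ((h'.summable.prod_factor m).mul_right (((q : ℂ) ^ m)⁻¹)).congr fun l => ?_
      rw [mul_assoc, mul_inv_cancel₀ (pow_ne_zero _ (by exact_mod_cast h0.ne')), mul_one]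
    exact h'.prod_fiberwise hsum
  have h0 := f.hasSum_coeff_tripleEquiv_zero 0
  have h := (f.hasSum_coeff_tripleEquiv_zero n).sub (h0.mul_left (PowerSeries.coeff n e))
  rw [map_zero, fourierIndex_zero] at h
  exact sub_eq_zero.1 (h.tsum_eq.symm.trans (hcol 0))

end SiegelModularForm

end SiegelPhi

section ReductionModP

variable {p : ℕ} [Fact p.Prime] {σ τ : Type*}

theorem aeval_map_subtype (P : MvPolynomial τ (pIntegers p)) (g : τ → ℂ) :
    MvPolynomial.aeval g (P.map (pIntegers p).subtype) = P.eval₂ (pIntegersToComplex p) g := by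
  rw [MvPolynomial.aeval_def, MvPolynomial.eval₂_map]
  rfl

theorem map_pIntegersMod_aeval (γ : τ → MvPowerSeries σ (pIntegers p))
    (P : MvPolynomial τ (pIntegers p)) :
    MvPowerSeries.map (pIntegersMod p) (MvPolynomial.aeval γ P) =
      MvPolynomial.aeval (fun i => MvPowerSeries.map (pIntegersMod p) (γ i))
        (P.map (pIntegersMod p)) := by
  induction P using MvPolynomial.induction_on with
  | C a => simp [MvPowerSeries.algebraMap_apply]
  | add P Q hP hQ => simp [hP, hQ]
  | mul_X P i hP => simp [hP]

theorem map_subtype_injective :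
    Function.Injective (MvPolynomial.map (σ := σ) (pIntegers p).subtype) :=
  MvPolynomial.map_injective _ Subtype.val_injective

theorem modCongr_coeff_iff (P : MvPolynomial σ (pIntegers p)) :
    (∀ m, ModCongr p 1 (((P.map (pIntegers p).subtype).coeff m : ℚ) : ℂ) 0) ↔
      P.map (pIntegersMod p) = 0 := by
  rw [MvPolynomial.ext_iff]
  refine forall_congr' fun m => ?_
  rw [MvPolynomial.coeff_map, MvPolynomial.coeff_map, MvPolynomial.coeff_zero, ← modCongr_zero_iff]
  rfl

theorem exists_eq_natCast_mul_of_map_eq_zero {F : MvPowerSeries σ (pIntegers p)}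
    (hF : MvPowerSeries.map (pIntegersMod p) F = 0) (d : σ →₀ ℕ) :
    ∃ r : pIntegers p, MvPowerSeries.coeff d F = p * r :=
  pIntegersMod_eq_zero_iff.1 (by rw [← MvPowerSeries.coeff_map, hF, map_zero])

/-- An isobaric polynomial in generators which vanishes modulo `p` is divisible by `p`. -/
theorem eq_zero_of_aeval_mod_eq_zero [Fintype τ]
    {Γ : Set (Matrix (Fin 2 ⊕ Fin 2) (Fin 2 ⊕ Fin 2) ℤ)} {w : τ → ℕ} (hw : ∀ i, Even (w i))
    (G : ∀ i, SiegelModularForm 2 (w i : ℤ) Γ 1) {γ : τ → MvPowerSeries (Fin 3) (pIntegers p)}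
    (hγ : ∀ i, MvPowerSeries.map (pIntegersToComplex p) (γ i) = (G i).fourierSeries)
    (hindep : ∀ P : MvPolynomial τ ℚ, (∀ Z ∈ SiegelUpperHalfSpace 2,
      MvPolynomial.aeval (fun i => (G i).toFun Z) P = 0) → P = 0)
    (hgen : ∀ k : ℤ, Even k → ∀ f : SiegelModularForm 2 k Γ 1,
      (∀ T, IsPIntegral p (f.coeff T)) → ∃ P : MvPolynomial τ ℚ,
        (∀ m, IsPIntegral p ((P.coeff m : ℚ) : ℂ)) ∧
        ∀ Z ∈ SiegelUpperHalfSpace 2,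
          f.toFun Z = MvPolynomial.aeval (fun i => (G i).toFun Z) P)
    {n : ℕ} {f : MvPolynomial τ (ZMod p)} (hf : f.IsWeightedHomogeneous w n)
    (h0 : MvPolynomial.aeval (fun i => MvPowerSeries.map (pIntegersMod p) (γ i)) f = 0) :
    f = 0 := by
  have hp0 : (p : ℂ) ≠ 0 := Nat.cast_ne_zero.2 (Fact.out : p.Prime).ne_zero
  by_cases hf0 : f = 0
  · exact hf0
  have hn : Even (n : ℤ) := by
    obtain ⟨d, hd⟩ := MvPolynomial.ne_zero_iff.1 hf0
    rw [← hf hd, Finsupp.weight_apply, Int.even_coe_nat]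
    exact Finset.even_sum _ fun i _ => (hw i).mul_left _
  obtain ⟨g, hg, rfl⟩ := exists_isWeightedHomogeneous_map_eq hf
  rw [← map_pIntegersMod_aeval] at h0
  obtain ⟨F, hF, hFc⟩ := SiegelModularForm.exists_eq_const_mul_eval₂ G hγ hg (p : ℂ)⁻¹
  obtain ⟨P, hPint, hP⟩ := hgen n hn F fun T => by
    rw [hFc, isPIntegral_iff]
    by_cases hT : ∃ d, fourierIndex d = T
    · obtain ⟨d, rfl⟩ := hT
      obtain ⟨r, hr⟩ := exists_eq_natCast_mul_of_map_eq_zero h0 d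
      refine ⟨r, ?_⟩
      rw [fourierIndex_injective.extend_apply, hr, map_mul, map_natCast,
        inv_mul_cancel_left₀ hp0]
    · exact ⟨0, by rw [Function.extend_apply' _ _ _ hT, map_zero]; rfl⟩
  obtain ⟨P, rfl⟩ := exists_map_eq_of_isPIntegral hPint
  have key : g = MvPolynomial.C (p : pIntegers p) * P := by
    refine sub_eq_zero.1 (map_subtype_injective ?_)
    rw [map_zero]
    refine hindep _ fun Z hZ => ?_
    have h := hP Z hZ
    rw [hF, aeval_map_subtype, inv_mul_eq_iff_eq_mul₀ hp0] at h
    rw [aeval_map_subtype, MvPolynomial.eval₂_sub, MvPolynomial.eval₂_mul, MvPolynomial.eval₂_C,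
      map_natCast, h, sub_self]
  rw [key]
  simp

end ReductionModP

section Squarefree

open MvPolynomial

/-- The substitution `x₃ = x₄ = 0`. -/
def killCuspForms (R : Type*) [CommRing R] : MvPolynomial (Fin 4) R →ₐ[R] MvPolynomial (Fin 2) R :=
  aeval ![X 0, X 1, 0, 0]

theorem isWeightedHomogeneous_killCuspForms {R : Type*} [CommRing R] {n : ℕ}
    {f : MvPolynomial (Fin 4) R} (hf : f.IsWeightedHomogeneous ![4, 6, 10, 12] n) :
    (killCuspForms R f).IsWeightedHomogeneous ![4, 6] n := by
  have hX : ∀ i : Fin 4, IsWeightedHomogeneous (![4, 6] : Fin 2 → ℕ)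
      ((![X 0, X 1, 0, 0] : Fin 4 → MvPolynomial (Fin 2) R) i)
      ((![4, 6, 10, 12] : Fin 4 → ℕ) i) := by
    intro i
    fin_cases i
    · exact isWeightedHomogeneous_X R _ 0
    · exact isWeightedHomogeneous_X R _ 1
    · exact isWeightedHomogeneous_zero R _ _
    · exact isWeightedHomogeneous_zero R _ _
  rw [f.as_sum, map_sum]
  refine IsWeightedHomogeneous.sum _ _ _ fun d hd => ?_
  rw [← hf (mem_support_iff.1 hd), killCuspForms, aeval_monomial, Finsupp.weight_apply,
    ← zero_add (d.sum _)]
  refine (isWeightedHomogeneous_C _ _).mul ?_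
  exact IsWeightedHomogeneous.prod _ _ _ fun i _ => (hX i).pow _

theorem squarefree_of_squarefree_killCuspForms {K : Type*} [Field K] {n : ℕ}
    {f : MvPolynomial (Fin 4) K} (hf0 : f ≠ 0) (hf : f.IsWeightedHomogeneous ![4, 6, 10, 12] n)
    (hsq : Squarefree (killCuspForms K f)) : Squarefree f := by
  intro b hb
  obtain ⟨m, -, hm⟩ := _root_.IsWeightedHomogeneous.of_dvd hf hf0 ((dvd_mul_right b b).trans hb)
  have hu : IsUnit (killCuspForms K b) := hsq _ (by rw [← map_mul]; exact map_dvd _ hb)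
  have hm0 : m = 0 := by
    by_contra h
    exact not_isUnit_of_isWeightedHomogeneous (isWeightedHomogeneous_killCuspForms hm) h hu
  subst hm0
  have hC := eq_C_of_isWeightedHomogeneous_zero
    (by intro i; fin_cases i <;> simp) hm
  rw [hC]
  refine (IsUnit.mk0 _ fun h => ?_).map C
  rw [hC, h, map_zero, mul_zero, zero_dvd_iff] at hb
  exact hf0 hb

end Squarefree

section RestrictionModP

open UpperHalfPlane ModularForm
open scoped MatrixGroups

variable {p : ℕ} [Fact p.Prime]

namespace SiegelModularForm

theorem map_pIntegersMod_mem_supportedSubalgebra {k : ℤ}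
    {Γ : Set (Matrix (Fin 2 ⊕ Fin 2) (Fin 2 ⊕ Fin 2) ℤ)} {f : SiegelModularForm 2 k Γ 1}
    {γ : MvPowerSeries (Fin 3) (pIntegers p)}
    (hγ : MvPowerSeries.map (pIntegersToComplex p) γ = f.fourierSeries) :
    MvPowerSeries.map (pIntegersMod p) γ ∈ supportedSubalgebra (ZMod p) siegelCone := by
  intro d hd
  have h := f.fourierSeries_mem d hd
  rw [← hγ, MvPowerSeries.coeff_map] at h
  rw [MvPowerSeries.coeff_map,
    pIntegersToComplex_injective (h.trans (map_zero (pIntegersToComplex p)).symm), map_zero]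

theorem rayRestriction_map_pIntegersMod {k c : ℤ} {j : ℕ}
    {Γ : Set (Matrix (Fin 2 ⊕ Fin 2) (Fin 2 ⊕ Fin 2) ℤ)} {f : SiegelModularForm 2 k Γ 1}
    {γ : MvPowerSeries (Fin 3) (pIntegers p)}
    (hγ : MvPowerSeries.map (pIntegersToComplex p) γ = f.fourierSeries)
    (hf : ∀ n, f.coeff (fourierIndex (siegelRay n)) =
      PowerSeries.coeff n (sigmaSeries ℂ c j)) :
    rayRestriction siegelRay (MvPowerSeries.map (pIntegersMod p) γ) =
      sigmaSeries (ZMod p) c j := by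
  ext n
  have h := hf n
  rw [← coeff_fourierSeries, ← hγ, MvPowerSeries.coeff_map,
    ← map_sigmaSeries (pIntegersToComplex p), PowerSeries.coeff_map] at h
  rw [rayRestriction, PowerSeries.coeff_mk, MvPowerSeries.coeff_map,
    pIntegersToComplex_injective h, ← PowerSeries.coeff_map, map_sigmaSeries]

theorem rayRestriction_map_pIntegersMod_eq_zero {k : ℤ}
    {Γ : Set (Matrix (Fin 2 ⊕ Fin 2) (Fin 2 ⊕ Fin 2) ℤ)} {f : SiegelModularForm 2 k Γ 1}
    {γ : MvPowerSeries (Fin 3) (pIntegers p)}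
    (hγ : MvPowerSeries.map (pIntegersToComplex p) γ = f.fourierSeries)
    (hf : ∀ T, ¬ (T.map (fun q => (q : ℝ))).PosDef → f.coeff T = 0) :
    rayRestriction siegelRay (MvPowerSeries.map (pIntegersMod p) γ) = 0 := by
  ext n
  have h := hf _ (not_posDef_fourierIndex_siegelRay n)
  rw [← coeff_fourierSeries, ← hγ, MvPowerSeries.coeff_map] at h
  rw [rayRestriction, PowerSeries.coeff_mk, MvPowerSeries.coeff_map, map_zero,
    pIntegersToComplex_injective (h.trans (map_zero (pIntegersToComplex p)).symm), map_zero]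

theorem coeff_siegelRay_weight_four (f : SiegelModularForm 2 4 (SiegelModularGroup 2) 1)
    (hf : f.coeff 0 = 1) (n : ℕ) :
    f.coeff (fourierIndex (siegelRay n)) = PowerSeries.coeff n (sigmaSeries ℂ 240 3) := by
  have h := coeff_siegelRay (k := 4) (by norm_num) f hasQSeries_E₄ (ModularForm.slash_SL_eq E₄)
    (coeff_zero_sigmaSeries _ _ _) n
  rwa [hf, mul_one] at h

theorem coeff_siegelRay_weight_six (f : SiegelModularForm 2 6 (SiegelModularGroup 2) 1)
    (hf : f.coeff 0 = 1) (n : ℕ) :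
    f.coeff (fourierIndex (siegelRay n)) = PowerSeries.coeff n (sigmaSeries ℂ (-504) 5) := by
  have h := coeff_siegelRay (k := 6) (by norm_num) f hasQSeries_E₆ (ModularForm.slash_SL_eq E₆)
    (coeff_zero_sigmaSeries _ _ _) n
  rwa [hf, mul_one] at h

end SiegelModularForm

theorem squarefree_of_aeval_eq_one (hp5 : 5 ≤ p) {γ : Fin 4 → MvPowerSeries (Fin 3) (ZMod p)}
    (hγ : ∀ i, γ i ∈ supportedSubalgebra (ZMod p) siegelCone)
    (hray : ∀ i, rayRestriction siegelRay (γ i) =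
      (![sigmaSeries (ZMod p) 240 3, sigmaSeries (ZMod p) (-504) 5, 0, 0] :
        Fin 4 → PowerSeries (ZMod p)) i)
    {A : MvPolynomial (Fin 4) (ZMod p)} (hA : A.IsWeightedHomogeneous ![4, 6, 10, 12] (p - 1))
    (hA1 : MvPolynomial.aeval γ A = 1) : Squarefree A := by
  refine squarefree_of_squarefree_killCuspForms ?_ hA
    ((isRamanujanTriple_sigmaSeries (ZMod p)).squarefree_of_aeval_eq_one hp5
      (isWeightedHomogeneous_killCuspForms hA) ?_)
  · rintro rfl
    exact zero_ne_one ((map_zero _).symm.trans hA1)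
  · have hface := fun P => rayRestriction_aeval siegelRay_injective
      (fun d hd e he n => mem_range_siegelRay_of_add hd he) hγ P
    have h := hface A
    have h1 := hface 1
    rw [map_one, map_one] at h1
    rw [hA1, h1] at h
    rw [h, killCuspForms, ← AlgHom.comp_apply, MvPolynomial.comp_aeval]
    congr 2
    ext1 i
    rw [hray]
    fin_cases i <;> simp

theorem weight_four_six_ten_twelve (d : Fin 4 →₀ ℕ) :
    Finsupp.weight ![4, 6, 10, 12] d = 4 * d 0 + 6 * d 1 + 10 * d 2 + 12 * d 3 := by
  rw [Finsupp.weight_apply, Finsupp.sum_fintype _ _ (by simp)]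
  simp [Fin.sum_univ_four, mul_comm]

end RestrictionModP

section Congruences

variable {p : ℕ} [Fact p.Prime] {τ : Type*}

/-- A family of even-weight forms sums to zero modulo `p` exactly when its polynomial does. -/
theorem forall_modCongr_sum_coeff_iff {Γ : Set (Matrix (Fin 2 ⊕ Fin 2) (Fin 2 ⊕ Fin 2) ℤ)}
    {γ : τ → MvPowerSeries (Fin 3) (pIntegers p)} {s : ℕ} {k : Fin s → ℤ}
    {f : ∀ i, SiegelModularForm 2 (k i) Γ 1} {P : Fin s → MvPolynomial τ (pIntegers p)}
    (hf : ∀ i, (f i).fourierSeries =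
      MvPowerSeries.map (pIntegersToComplex p) (MvPolynomial.aeval γ (P i))) :
    (∀ T, ModCongr p 1 (∑ i, (f i).coeff T) 0) ↔
      MvPolynomial.aeval (fun i => MvPowerSeries.map (pIntegersMod p) (γ i))
        ((∑ i, P i).map (pIntegersMod p)) = 0 := by
  have hsum : ∀ d, ∑ i, (f i).coeff (fourierIndex d) =
      pIntegersToComplex p (MvPowerSeries.coeff d (MvPolynomial.aeval γ (∑ i, P i))) := by
    intro d
    simp only [map_sum, ← MvPowerSeries.coeff_map, ← hf, SiegelModularForm.coeff_fourierSeries]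
  rw [← map_pIntegersMod_aeval]
  constructor
  · intro h
    ext d
    rw [MvPowerSeries.coeff_map, map_zero, ← modCongr_zero_iff, ← hsum]
    exact h _
  · intro h T
    by_cases hT : T ∈ SiegelLattice 2 1
    · obtain ⟨d, rfl⟩ := exists_fourierIndex_eq hT
      rw [hsum, modCongr_zero_iff, ← MvPowerSeries.coeff_map, h, map_zero]
    · rw [Finset.sum_eq_zero fun i _ => by_contra fun h => hT ((f i).coeff_supported T h),
        ← map_zero (pIntegersToComplex p), modCongr_iff]

theorem map_pIntegersMod_eq_one {k : ℤ} {Γ : Set (Matrix (Fin 2 ⊕ Fin 2) (Fin 2 ⊕ Fin 2) ℤ)}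
    {f : SiegelModularForm 2 k Γ 1} {γ : MvPowerSeries (Fin 3) (pIntegers p)}
    (hγ : f.fourierSeries = MvPowerSeries.map (pIntegersToComplex p) γ)
    (hf0 : ModCongr p 1 (f.coeff 0) 1) (hf : ∀ T, T ≠ 0 → ModCongr p 1 (f.coeff T) 0) :
    MvPowerSeries.map (pIntegersMod p) γ = 1 := by
  classical
  have hcoeff : ∀ d, f.coeff (fourierIndex d) =
      pIntegersToComplex p (MvPowerSeries.coeff d γ) := fun d => by
    rw [← SiegelModularForm.coeff_fourierSeries, hγ, MvPowerSeries.coeff_map]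
  ext d
  rw [MvPowerSeries.coeff_map, MvPowerSeries.coeff_one]
  split_ifs with hd
  · rw [← fourierIndex_zero, hcoeff, ← map_one (pIntegersToComplex p), modCongr_iff, map_one] at hf0
    rw [hd, hf0]
  · rw [← modCongr_zero_iff, ← hcoeff]
    refine hf _ fun h => hd (fourierIndex_injective ?_)
    rw [h, fourierIndex_zero]

/-- Congruence to a multiple of `A - 1` is divisibility by `A - 1` over `ZMod p`. -/
theorem exists_modCongr_sub_mul_iff {P A : MvPolynomial τ (pIntegers p)} :
    (∃ Q : MvPolynomial τ ℚ, (∀ m, IsPIntegral p ((Q.coeff m : ℚ) : ℂ)) ∧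
      ∀ m, ModCongr p 1 (((P.map (pIntegers p).subtype -
        Q * (A.map (pIntegers p).subtype - 1)).coeff m : ℚ) : ℂ) 0) ↔
      A.map (pIntegersMod p) - 1 ∣ P.map (pIntegersMod p) := by
  have key : ∀ Q : MvPolynomial τ (pIntegers p), (∀ m, ModCongr p 1
      (((P.map (pIntegers p).subtype - Q.map (pIntegers p).subtype *
        (A.map (pIntegers p).subtype - 1)).coeff m : ℚ) : ℂ) 0) ↔
      P.map (pIntegersMod p) = Q.map (pIntegersMod p) * (A.map (pIntegersMod p) - 1) := by
    intro Q
    have h := modCongr_coeff_iff (P - Q * (A - 1))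
    simp only [map_sub, map_mul, map_one] at h
    rw [h, sub_eq_zero]
  constructor
  · rintro ⟨Q, hQ, h⟩
    obtain ⟨Q, rfl⟩ := exists_map_eq_of_isPIntegral hQ
    exact ⟨_, ((key Q).1 h).trans (mul_comm _ _)⟩
  · rintro ⟨Q, h⟩
    obtain ⟨Q, rfl⟩ := MvPolynomial.map_surjective _ pIntegersMod_surjective Q
    refine ⟨Q.map (pIntegers p).subtype, fun m => ?_, (key Q).2 (h.trans (mul_comm _ _))⟩
    rw [MvPolynomial.coeff_map, isPIntegral_ratCast_iff]
    exact (Q.coeff m).2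

end Congruences

/-- **Nagaoka's structure theorem for Siegel modular forms mod p of degree 2 and
even weight** (Theorem 3.1). Let `p ≥ 5` and let `G₄, G₆, X₁₀, X₁₂` be the
standard normalized generators (over `ℤ_(p)`) of the graded ring of even-weight
Siegel modular forms of degree 2, `F_{p-1} ≡ 1 (mod p)` a form of weight
`p - 1`, and `A` a polynomial with `F_{p-1} = A(G₄, G₆, X₁₀, X₁₂)`. Then the
algebra `M̃^{(e)}(Γ₂)_p` of Siegel modular forms mod `p` of even weight is
`𝔽_p[x₁, x₂, x₃, x₄]/(Ã - 1)`: an even-weight `p`-integral family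
`f_i = P_i(G₄, G₆, X₁₀, X₁₂)` has `Σ_i f_i ≡ 0 (mod p)` coefficientwise iff
`Σ_i P̃_i` lies in the principal ideal `(Ã - 1)`, i.e. iff
`Σ_i P_i ≡ Q·(A - 1) (mod p)` for some `p`-integral polynomial `Q`. -/
theorem siegel_mod_p_structure_theorem
    (p : ℕ) (hp : Nat.Prime p) (hp5 : 5 ≤ p)
    (G4 : SiegelModularForm 2 4 (SiegelModularGroup 2) 1)
    (G6 : SiegelModularForm 2 6 (SiegelModularGroup 2) 1)
    (X10 : SiegelModularForm 2 10 (SiegelModularGroup 2) 1)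
    (X12 : SiegelModularForm 2 12 (SiegelModularGroup 2) 1)
    (hG4int : ∀ T, IsPIntegral p (G4.coeff T))
    (hG6int : ∀ T, IsPIntegral p (G6.coeff T))
    (hX10int : ∀ T, IsPIntegral p (X10.coeff T))
    (hX12int : ∀ T, IsPIntegral p (X12.coeff T))
    (hG4norm : G4.coeff 0 = 1) (hG6norm : G6.coeff 0 = 1)
    (hX10cusp : ∀ T, ¬ (T.map (fun q => (q : ℝ))).PosDef → X10.coeff T = 0)
    (hX12cusp : ∀ T, ¬ (T.map (fun q => (q : ℝ))).PosDef → X12.coeff T = 0)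
    (hX10norm : X10.coeff !![1, 1/2; 1/2, 1] = 1)
    (hX12norm : X12.coeff !![1, 1/2; 1/2, 1] = 1)
    (hindep : ∀ P : MvPolynomial (Fin 4) ℚ,
      (∀ Z ∈ SiegelUpperHalfSpace 2,
        MvPolynomial.aeval (![G4.toFun Z, G6.toFun Z, X10.toFun Z, X12.toFun Z]) P = 0) →
      P = 0)
    (hgen : ∀ k : ℤ, Even k →
      ∀ f : SiegelModularForm 2 k (SiegelModularGroup 2) 1,
        (∀ T, IsPIntegral p (f.coeff T)) →
        ∃ P : MvPolynomial (Fin 4) ℚ,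
          (∀ m, IsPIntegral p ((P.coeff m : ℚ) : ℂ)) ∧
          (∀ m ∈ P.support, 4 * (m 0 : ℤ) + 6 * (m 1 : ℤ) + 10 * (m 2 : ℤ) + 12 * (m 3 : ℤ) = k) ∧
          ∀ Z ∈ SiegelUpperHalfSpace 2,
            f.toFun Z =
              MvPolynomial.aeval (![G4.toFun Z, G6.toFun Z, X10.toFun Z, X12.toFun Z]) P)
    (F : SiegelModularForm 2 ((p : ℤ) - 1) (SiegelModularGroup 2) 1)
    (hFint : ∀ T, IsPIntegral p (F.coeff T))
    (hFone0 : ModCongr p 1 (F.coeff 0) 1)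
    (hFone : ∀ T, T ≠ 0 → ModCongr p 1 (F.coeff T) 0)
    (A : MvPolynomial (Fin 4) ℚ)
    (hAint : ∀ m, IsPIntegral p ((A.coeff m : ℚ) : ℂ))
    (hFA : ∀ Z ∈ SiegelUpperHalfSpace 2,
      F.toFun Z = MvPolynomial.aeval (![G4.toFun Z, G6.toFun Z, X10.toFun Z, X12.toFun Z]) A) :
    ∀ (s : ℕ) (k : Fin s → ℤ), (∀ i, Even (k i)) →
      ∀ f : (i : Fin s) → SiegelModularForm 2 (k i) (SiegelModularGroup 2) 1,
        (∀ i T, IsPIntegral p ((f i).coeff T)) →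
        ∀ P : Fin s → MvPolynomial (Fin 4) ℚ,
          (∀ i m, IsPIntegral p (((P i).coeff m : ℚ) : ℂ)) →
          (∀ i, ∀ m ∈ (P i).support,
            4 * (m 0 : ℤ) + 6 * (m 1 : ℤ) + 10 * (m 2 : ℤ) + 12 * (m 3 : ℤ) = k i) →
          (∀ i, ∀ Z ∈ SiegelUpperHalfSpace 2,
            (f i).toFun Z =
              MvPolynomial.aeval (![G4.toFun Z, G6.toFun Z, X10.toFun Z, X12.toFun Z]) (P i)) →
          ((∀ T, ModCongr p 1 (∑ i, (f i).coeff T) 0) ↔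
            ∃ Q : MvPolynomial (Fin 4) ℚ,
              (∀ m, IsPIntegral p ((Q.coeff m : ℚ) : ℂ)) ∧
              ∀ m, ModCongr p 1 ((((∑ i, P i) - Q * (A - 1)).coeff m : ℚ) : ℂ) 0) := by
  have : Fact p.Prime := ⟨hp⟩
  have : IsDomain (MvPowerSeries (Fin 3) (ZMod p)) := NoZeroDivisors.to_isDomain _
  let G : ∀ i : Fin 4, SiegelModularForm 2 (((![4, 6, 10, 12] : Fin 4 → ℕ) i : ℕ) : ℤ)
      (SiegelModularGroup 2) 1 := fun i => match i with
    | 0 => G4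
    | 1 => G6
    | 2 => X10
    | 3 => X12
  have hG : ∀ Z, ![G4.toFun Z, G6.toFun Z, X10.toFun Z, X12.toFun Z] =
      fun i => (G i).toFun Z := by
    intro Z
    ext i
    fin_cases i <;> rfl
  simp only [hG] at hindep hgen hFA ⊢
  have hGint : ∀ i T, IsPIntegral p ((G i).coeff T) := by
    intro i
    fin_cases i
    exacts [hG4int, hG6int, hX10int, hX12int]
  choose γ hγ using fun i => exists_map_eq_of_isPIntegral_coeff (F := (G i).fourierSeries)
    fun d => hGint i (fourierIndex d)
  have hfourier : ∀ {k : ℤ} {f : SiegelModularForm 2 k (SiegelModularGroup 2) 1}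
      {P : MvPolynomial (Fin 4) (pIntegers p)}, (∀ Z ∈ SiegelUpperHalfSpace 2, f.toFun Z =
        MvPolynomial.aeval (fun i => (G i).toFun Z) (P.map (pIntegers p).subtype)) →
      f.fourierSeries =
        MvPowerSeries.map (pIntegersToComplex p) (MvPolynomial.aeval γ P) := fun h =>
    SiegelModularForm.fourierSeries_eq_map_aeval G hγ
      fun Z hZ => (h Z hZ).trans (aeval_map_subtype _ _)
  obtain ⟨A, rfl⟩ := exists_map_eq_of_isPIntegral hAint
  have hAhom : (A.map (pIntegersMod p)).IsWeightedHomogeneous ![4, 6, 10, 12] (p - 1) := by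
    have hpodd : Odd p := hp.odd_of_ne_two (by omega)
    obtain ⟨B, -, hBhom, hB⟩ := hgen _ (((Int.odd_coe_nat p).2 hpodd).sub_odd odd_one) F hFint
    have hAB : A.map (pIntegers p).subtype = B := by
      refine sub_eq_zero.1 (hindep _ fun Z hZ => ?_)
      rw [map_sub, ← hFA Z hZ, ← hB Z hZ, sub_self]
    intro m hm
    have hmB : m ∈ B.support := by
      rw [← hAB, MvPolynomial.mem_support_iff, MvPolynomial.coeff_map]
      intro h
      refine hm ?_
      rw [MvPolynomial.coeff_map, show A.coeff m = 0 from Subtype.ext h, map_zero]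
    have := hBhom m hmB
    rw [weight_four_six_ten_twelve]
    omega
  have hA1 : MvPolynomial.aeval (fun i => MvPowerSeries.map (pIntegersMod p) (γ i))
      (A.map (pIntegersMod p)) = 1 := by
    rw [← map_pIntegersMod_aeval]
    exact map_pIntegersMod_eq_one (hfourier hFA) hFone0 hFone
  have hsq : Squarefree (A.map (pIntegersMod p)) := by
    refine squarefree_of_aeval_eq_one hp5
      (fun i => SiegelModularForm.map_pIntegersMod_mem_supportedSubalgebra (hγ i)) (fun i => ?_)
      hAhom hA1
    fin_cases i
    · exact SiegelModularForm.rayRestriction_map_pIntegersMod (hγ 0)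
        (SiegelModularForm.coeff_siegelRay_weight_four G4 hG4norm)
    · exact SiegelModularForm.rayRestriction_map_pIntegersMod (hγ 1)
        (SiegelModularForm.coeff_siegelRay_weight_six G6 hG6norm)
    · exact SiegelModularForm.rayRestriction_map_pIntegersMod_eq_zero (hγ 2) hX10cusp
    · exact SiegelModularForm.rayRestriction_map_pIntegersMod_eq_zero (hγ 3) hX12cusp
  have hev : ∀ n f, MvPolynomial.IsWeightedHomogeneous ![4, 6, 10, 12] f n →
      (MvPolynomial.aeval (R := ZMod p)
        fun i => MvPowerSeries.map (pIntegersMod p) (γ i)).toRingHom f = 0 → f = 0 :=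
    fun n f hf h0 => eq_zero_of_aeval_mod_eq_zero
      (by intro i; fin_cases i <;> decide) G hγ hindep
      (fun k hk f hf => (hgen k hk f hf).imp fun P hP => ⟨hP.1, hP.2.2⟩) hf h0
  intro s k _ f _ P hP _ hfP
  choose P' hP' using fun i => exists_map_eq_of_isPIntegral (hP i)
  obtain rfl : (fun i => (P' i).map (pIntegers p).subtype) = P := funext hP'
  rw [forall_modCongr_sum_coeff_iff fun i => hfourier (hfP i), ← map_sum,
    exists_modCongr_sub_mul_iff]
  constructor
  · exact fun h => sub_one_dvd_of_map_eq_zero hev hAhom hA1 hsq h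
  · rintro ⟨Q, hQ⟩
    rw [hQ, map_mul, map_sub, hA1, map_one, sub_self, zero_mul]

end
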